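/- Let A be an n × m matrix whose entries are independent standard normal random variables. Then for any t with 0 < t < √n − √m, with probability at least 1 − 2·exp(−t²/2), the m × m matrix (1/n)·AᵀA satisfies both ‖(1/n)·AᵀA − I_m‖ ≤ 3·(√m + t)/√n in operator norm and det((1/n)·AᵀA) ≥ exp(−m·((√m + t)²/n + 2·(√m + t)/√n)). -/

import Mathlib

open MeasureTheory ProbabilityTheory Matrix

/-- The distribution of an `n × m` matrix with i.i.d. standard normal entries. -/
noncomputable def gaussMatrix (n m : ℕ) : Measure (Fin n → Fin m → ℝ) :=
  Measure.pi fun _ => Measure.pi fun _ => gaussianReal 0 1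

namespace RG

/-- Gaussian-type density. -/
def GD {V : Type*} [MeasureSpace V] [TopologicalSpace V] (μ : Measure V) (q : V → ℝ) : Prop :=
  ∃ C : ℝ, 0 ≤ C ∧ Continuous q ∧ Integrable (fun x => C * Real.exp (-(q x) / 2)) ∧
    μ = (volume : Measure V).withDensity (fun x => ENNReal.ofReal (C * Real.exp (-(q x) / 2)))

lemma GD.pi {ι : Type*} [Fintype ι] {V : Type*} [MeasureSpace V] [TopologicalSpace V]
    [BorelSpace V] [SigmaFinite (volume : Measure V)]
    {μ : Measure V} [SigmaFinite μ] {q : V → ℝ} (h : GD μ q) :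
    GD (Measure.pi fun _ : ι => μ) (fun x => ∑ i, q (x i)) := by
  obtain ⟨C, hC, hq, hI, hμ⟩ := h
  have key : ∀ x : ι → V, C ^ (Fintype.card ι) * Real.exp (-(∑ i, q (x i)) / 2)
      = ∏ i, (C * Real.exp (-(q (x i)) / 2)) := by
    intro x
    rw [Finset.prod_mul_distrib, ← Real.exp_sum]
    simp only [Finset.prod_const, Finset.card_univ]
    congr 2
    rw [← Finset.sum_div, Finset.sum_neg_distrib]
  refine ⟨C ^ (Fintype.card ι), pow_nonneg hC _, by fun_prop, ?_, ?_⟩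
  · simp_rw [key]
    exact Integrable.fintype_prod (f := fun _ v => C * Real.exp (-(q v) / 2)) (fun _ => hI)
  · simp_rw [key]
    apply Measure.pi_eq
    intro s hs
    have hm : ∀ v, 0 ≤ C * Real.exp (-(q v) / 2) := fun v => by positivity
    rw [withDensity_apply _ (MeasurableSet.univ_pi hs)]
    have e1 : (volume : Measure (ι → V)).restrict (Set.univ.pi s)
      = Measure.pi (fun i => (volume : Measure V).restrict (s i)) := Measure.restrict_pi_pi _ _
    rw [e1, ← ofReal_integral_eq_lintegral_ofReal, 
      integral_fintype_prod_eq_prod (f := fun _ v => C * Real.exp (-(q v) / 2)),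
      ENNReal.ofReal_prod_of_nonneg]
    · apply Finset.prod_congr rfl
      intro i _
      rw [hμ, withDensity_apply _ (hs i), ofReal_integral_eq_lintegral_ofReal]
      · exact hI.integrableOn
      · exact Filter.Eventually.of_forall hm
    · intro i _
      exact integral_nonneg hm
    · exact Integrable.fintype_prod_dep (f := fun _ v => C * Real.exp (-(q v) / 2)) (fun _ => hI.integrableOn)
    · exact Filter.Eventually.of_forall (fun x => Finset.prod_nonneg (fun i _ => hm _))

lemma GD.prod {V W : Type*} [MeasureSpace V] [TopologicalSpace V]
    [BorelSpace V] [SigmaFinite (volume : Measure V)] [MeasureSpace W] [TopologicalSpace W]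
    [BorelSpace W] [SigmaFinite (volume : Measure W)]
    {μ : Measure V} {q : V → ℝ} (h : GD μ q) {ν : Measure W} {r : W → ℝ} (h' : GD ν r) :
    GD (μ.prod ν) (fun x => q x.1 + r x.2) := by
  obtain ⟨C, hC, hq, hI, hμ⟩ := h
  obtain ⟨D, hD, hr, hJ, hν⟩ := h'
  have key : ∀ x : V × W, C * D * Real.exp (-(q x.1 + r x.2) / 2)
      = (C * Real.exp (-(q x.1) / 2)) * (D * Real.exp (-(r x.2) / 2)) := by
    intro x
    rw [show -(q x.1 + r x.2) / 2 = -(q x.1)/2 + -(r x.2)/2 by ring, Real.exp_add]; ring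
  refine ⟨C * D, mul_nonneg hC hD, by fun_prop, ?_, ?_⟩
  · simp_rw [key]
    exact Integrable.mul_prod hI hJ
  · simp_rw [key]
    rw [hμ, hν]
    have m1 : Measurable (fun x => ENNReal.ofReal (C * Real.exp (-(q x) / 2))) := by
      have := hq.measurable
      fun_prop
    have m2 : Measurable (fun x => ENNReal.ofReal (D * Real.exp (-(r x) / 2))) := by
      have := hr.measurable
      fun_prop
    rw [prod_withDensity m1 m2]
    congr 1
    ext x
    rw [← ENNReal.ofReal_mul (by positivity)]

lemma GD.stein {V : Type*} [NormedAddCommGroup V] [NormedSpace ℝ V] [FiniteDimensional ℝ V]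
    [MeasureSpace V] [BorelSpace V] [(volume : Measure V).IsAddHaarMeasure]
    {μ : Measure V} {q : V → ℝ} (h : GD μ q) (d : V) (l : V → ℝ)
    (hl : ∀ x, HasLineDerivAt ℝ q (2 * l x) x d)
    (f f' : V → ℝ) (hf : ∀ x, HasLineDerivAt ℝ f (f' x) x d)
    (i1 : Integrable f μ) (i2 : Integrable f' μ) (i3 : Integrable (fun x => l x * f x) μ) :
    ∫ x, l x * f x ∂μ = ∫ x, f' x ∂μ := by
  obtain ⟨C, hC, hq, hI, hμ⟩ := h
  set ρ : V → ℝ := fun x => C * Real.exp (-(q x) / 2) with hρ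
  have hρ0 : ∀ x, 0 ≤ ρ x := fun x => by positivity
  have hm : Measurable (fun x => ENNReal.ofReal (ρ x)) := by
    have := hq.measurable
    fun_prop
  have conv : ∀ g : V → ℝ, Integrable g μ → Integrable (fun x => ρ x * g x) := by
    intro g hg
    rw [hμ, integrable_withDensity_iff_integrable_smul' hm (by simp)] at hg
    simpa [ENNReal.toReal_ofReal (hρ0 _)] using hg
  have convi : ∀ g : V → ℝ, ∫ x, g x ∂μ = ∫ x, ρ x * g x := by
    intro g
    rw [hμ, integral_withDensity_eq_integral_toReal_smul hm (by simp)]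
    simp [ENNReal.toReal_ofReal (hρ0 _)]
  have hρd : ∀ x, HasLineDerivAt ℝ ρ (-(l x * ρ x)) x d := by
    intro x
    have := hl x
    unfold HasLineDerivAt at this ⊢
    have h2 := ((this.neg.div_const 2).exp).const_mul C
    convert! h2 using 1
    simp [hρ]; ring
  have := integral_bilinear_hasLineDerivAt_right_eq_neg_left_of_integrable (μ := (volume : Measure V))
    (f := ρ) (f' := fun x => -(l x * ρ x)) (g := f) (g' := f') (v := d)
    (B := ContinuousLinearMap.mul ℝ ℝ) ?_ ?_ ?_ (fun x _ => hρd x) (fun x _ => hf x)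
  · rw [convi, convi]
    simp only [ContinuousLinearMap.mul_apply'] at this
    rw [this, ← integral_neg]
    congr 1; ext x; ring
  · have := (conv _ i3).neg
    simp only [ContinuousLinearMap.mul_apply']
    refine this.congr (Filter.Eventually.of_forall fun x => ?_)
    simp; ring
  · simpa using conv _ i2
  · simpa using conv _ i1

lemma GD_real : GD (gaussianReal 0 1) (fun x => x ^ 2) := by
  refine ⟨(√(2 * Real.pi))⁻¹, by positivity, by fun_prop, ?_, ?_⟩
  · have := integrable_gaussianPDFReal 0 1
    unfold gaussianPDFReal at this
    simpa using this
  · rw [gaussianReal_of_var_ne_zero _ one_ne_zero]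
    congr 1
    ext x
    simp [gaussianPDF, gaussianPDFReal]

lemma GD_mat (n m : ℕ) : GD (gaussMatrix n m) (fun A => ∑ i, ∑ j, (A i j) ^ 2) := by
  have h1 : GD (Measure.pi fun _ : Fin m => gaussianReal 0 1) _ := GD.pi GD_real
  exact GD.pi h1

instance (n m : ℕ) : IsProbabilityMeasure (gaussMatrix n m) := by
  unfold gaussMatrix; infer_instance

/-- Stein identity for the matrix in direction `(i,j)`. -/
lemma stein_mat (n m : ℕ) (i : Fin n) (j : Fin m) (f f' : (Fin n → Fin m → ℝ) → ℝ)
    (hf : ∀ x, HasLineDerivAt ℝ f (f' x) x (Pi.single i (Pi.single j 1)))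
    (i1 : Integrable f (gaussMatrix n m)) (i2 : Integrable f' (gaussMatrix n m))
    (i3 : Integrable (fun x => x i j * f x) (gaussMatrix n m)) :
    ∫ x, x i j * f x ∂(gaussMatrix n m) = ∫ x, f' x ∂(gaussMatrix n m) := by
  refine (GD_mat n m).stein _ (fun x => x i j) ?_ f f' hf i1 i2 i3
  intro x
  unfold HasLineDerivAt
  have : ∀ a b, HasDerivAt (fun t : ℝ => ((x + t • (Pi.single i (Pi.single j 1) : Fin n → Fin m → ℝ)) a b) ^ 2)
      (2 * x a b * (Pi.single i (Pi.single j 1) : Fin n → Fin m → ℝ) a b) 0 := by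
    intro a b
    have h1 : HasDerivAt (fun t : ℝ => x a b + t * (Pi.single i (Pi.single j 1) : Fin n → Fin m → ℝ) a b)
      (1 * (Pi.single i (Pi.single j 1) : Fin n → Fin m → ℝ) a b) 0 := 
      ((hasDerivAt_id (0:ℝ)).mul_const _).const_add _
    have := h1.pow 2
    convert! this using 1
    simp
  have h2 := HasDerivAt.fun_sum (fun a (_ : a ∈ Finset.univ) =>
    HasDerivAt.fun_sum (fun b (_ : b ∈ Finset.univ) => this a b))
  convert! h2 using 1
  rw [Finset.sum_eq_single i, Finset.sum_eq_single j]
  · simp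
  · intro b _ hb; simp [hb]
  · simp
  · intro b _ hb; simp [hb]
  · simp

/-- l1 norm. -/
noncomputable def l1 {n m : ℕ} (A : Fin n → Fin m → ℝ) : ℝ := ∑ i, ∑ j, |A i j|

lemma integrable_exp_abs (c : ℝ) : Integrable (fun x : ℝ => Real.exp (c * |x|)) (gaussianReal 0 1) := by
  have h1 := (integrable_exp_mul_gaussianReal (μ := 0) (v := 1) c).add (integrable_exp_mul_gaussianReal (μ := 0) (v := 1) (-c))
  refine h1.mono' (by fun_prop) (Filter.Eventually.of_forall fun x => ?_)
  simp only [Real.norm_eq_abs, Real.abs_exp, Pi.add_apply]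
  rcases abs_cases x with ⟨h, _⟩ | ⟨h, _⟩ <;> rw [h]
  · have := Real.exp_pos (-c * x); linarith
  · have := Real.exp_pos (c * x)
    rw [show c * -x = -c * x by ring]; linarith

lemma integrable_exp_l1 (n m : ℕ) (c : ℝ) :
    Integrable (fun A => Real.exp (c * l1 A)) (gaussMatrix n m) := by
  have h1 : Integrable (fun x : Fin m → ℝ => ∏ j, Real.exp (c * |x j|)) (Measure.pi fun _ => gaussianReal 0 1) :=
    Integrable.fintype_prod (f := fun _ v => Real.exp (c * |v|)) (fun _ => integrable_exp_abs c)
  have h2 : Integrable (fun x : Fin n → Fin m → ℝ => ∏ i, ∏ j, Real.exp (c * |x i j|)) (gaussMatrix n m) :=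
    Integrable.fintype_prod (f := fun _ (v : Fin m → ℝ) => ∏ j, Real.exp (c * |v j|)) (fun _ => h1)
  refine h2.congr (Filter.Eventually.of_forall fun x => ?_)
  simp only [l1, ← Real.exp_sum, Finset.mul_sum]

lemma abs_le_l1 {n m : ℕ} (A : Fin n → Fin m → ℝ) (i : Fin n) (j : Fin m) : |A i j| ≤ l1 A := by
  unfold l1
  calc |A i j| ≤ ∑ j, |A i j| := Finset.single_le_sum (f := fun j => |A i j|) (fun _ _ => abs_nonneg _) (Finset.mem_univ j)
    _ ≤ _ := Finset.single_le_sum (f := fun i => ∑ j, |A i j|) (fun _ _ => Finset.sum_nonneg fun _ _ => abs_nonneg _) (Finset.mem_univ i)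

lemma l1_nonneg {n m : ℕ} (A : Fin n → Fin m → ℝ) : 0 ≤ l1 A :=
  Finset.sum_nonneg fun _ _ => Finset.sum_nonneg fun _ _ => abs_nonneg _

lemma continuous_l1 {n m : ℕ} : Continuous (l1 : (Fin n → Fin m → ℝ) → ℝ) := by
  unfold l1; fun_prop

lemma integrable_of_exp_bound {n m : ℕ} (f : (Fin n → Fin m → ℝ) → ℝ) (hf : Measurable f) (C c : ℝ)
    (h : ∀ A, |f A| ≤ C * Real.exp (c * l1 A)) : Integrable f (gaussMatrix n m) :=
  ((integrable_exp_l1 n m c).const_mul C).mono' hf.aestronglyMeasurable (Filter.Eventually.of_forall h)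

/-- squared Frobenius exponential moment -/
lemma integral_exp_sq (a : ℝ) (ha : a < 1) :
    Integrable (fun x : ℝ => Real.exp (a * x ^ 2 / 2)) (gaussianReal 0 1) ∧ 
    ∫ x, Real.exp (a * x ^ 2 / 2) ∂(gaussianReal 0 1) = (√(1 - a))⁻¹ := by
  have e : ∀ x : ℝ, gaussianPDFReal 0 1 x * Real.exp (a * x ^ 2 / 2) = (√(2 * Real.pi))⁻¹ * Real.exp (- ((1 - a)/2) * x ^ 2) := by
    intro x
    simp only [gaussianPDFReal, NNReal.coe_one, mul_one, sub_zero]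
    rw [mul_assoc, ← Real.exp_add]
    congr 2; ring
  have hm : Measurable (gaussianPDF 0 1) := measurable_gaussianPDF 0 1
  constructor
  · rw [gaussianReal_of_var_ne_zero _ one_ne_zero, integrable_withDensity_iff_integrable_smul' hm (by simp [gaussianPDF])]
    simp only [toReal_gaussianPDF, smul_eq_mul, e]
    exact (integrable_exp_neg_mul_sq (by linarith)).const_mul _
  · rw [integral_gaussianReal_eq_integral_smul one_ne_zero]
    simp only [smul_eq_mul, e]
    rw [integral_const_mul, integral_gaussian, ← Real.sqrt_inv, ← Real.sqrt_inv, ← Real.sqrt_mul (by positivity)]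
    congr 1
    have := Real.pi_pos
    have : 1 - a ≠ 0 := by linarith
    field_simp

lemma integral_exp_frob (n : ℕ) (a : ℝ) (ha : a < 1) :
    Integrable (fun A => Real.exp (a * (∑ i, (A i 0) ^ 2) / 2)) (gaussMatrix n 1) ∧
    ∫ A, Real.exp (a * (∑ i, (A i 0) ^ 2) / 2) ∂(gaussMatrix n 1) = (√(1 - a))⁻¹ ^ n := by
  obtain ⟨h1, h2⟩ := integral_exp_sq a ha
  have e : ∀ A : Fin n → Fin 1 → ℝ, Real.exp (a * (∑ i, (A i 0) ^ 2) / 2) = ∏ i, ∏ j, Real.exp (a * (A i j) ^ 2 / 2) := by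
    intro A
    simp only [← Real.exp_sum]
    rw [Finset.mul_sum, Finset.sum_div]; simp
  simp_rw [e]
  have g1 : Integrable (fun x : Fin 1 → ℝ => ∏ j, Real.exp (a * (x j) ^ 2 / 2)) (Measure.pi fun _ => gaussianReal 0 1) :=
    Integrable.fintype_prod (f := fun _ v => Real.exp (a * v ^ 2 / 2)) (fun _ => h1)
  have g2 : ∫ x : Fin 1 → ℝ, ∏ j, Real.exp (a * (x j) ^ 2 / 2) ∂(Measure.pi fun _ => gaussianReal 0 1) = (√(1 - a))⁻¹ := by
    rw [integral_fintype_prod_eq_prod (f := fun _ v => Real.exp (a * v ^ 2 / 2))]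
    simp only [h2]; simp
  constructor
  · exact Integrable.fintype_prod (f := fun _ (v : Fin 1 → ℝ) => ∏ j, Real.exp (a * (v j) ^ 2 / 2)) (fun _ => g1)
  · unfold gaussMatrix
    rw [integral_fintype_prod_eq_prod (f := fun _ (v : Fin 1 → ℝ) => ∏ j, Real.exp (a * (v j) ^ 2 / 2))]
    simp only [g2]; simp

end RG

open MeasureTheory ProbabilityTheory Matrix
namespace RG

lemma mgf_up (n : ℕ) (hn : 1 ≤ n) (l e : ℝ) (hl : 0 < l) (he : 0 < e) :
    Integrable (fun A : Fin n → Fin 1 → ℝ => Real.exp (l * √(e + ∑ i, (A i 0) ^ 2))) (gaussMatrix n 1) ∧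
    ∫ A, Real.exp (l * √(e + ∑ i, (A i 0) ^ 2)) ∂(gaussMatrix n 1)
      ≤ Real.exp (e / 2) * Real.exp (l * √n + l ^ 2 / 2) := by
  have hn' : (0:ℝ) < √n := by positivity
  set a := l / (√n + l) with ha
  have ha0 : 0 < a := by positivity
  have ha1 : a < 1 := by rw [ha, div_lt_one (by positivity)]; linarith
  obtain ⟨h1, h2⟩ := integral_exp_frob n a ha1
  have pt : ∀ A : Fin n → Fin 1 → ℝ, Real.exp (l * √(e + ∑ i, (A i 0) ^ 2)) ≤
     Real.exp (a * e / 2 + l ^ 2 / (2 * a)) * Real.exp (a * (∑ i, (A i 0) ^ 2) / 2) := by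
    intro A
    rw [← Real.exp_add]
    apply Real.exp_le_exp.mpr
    set N := √(e + ∑ i, (A i 0) ^ 2) with hN
    have hN2 : N ^ 2 = e + ∑ i, (A i 0) ^ 2 := Real.sq_sqrt (by positivity)
    have : 0 ≤ (a * N - l) ^ 2 / (2 * a) := by positivity
    have e2 : (a * N - l) ^ 2 / (2 * a) = a * N ^ 2 / 2 + l ^ 2 / (2 * a) - l * N := by field_simp; ring
    rw [e2, hN2] at this
    linarith
  have hint := h1.const_mul (Real.exp (a * e / 2 + l ^ 2 / (2 * a)))
  have hI : Integrable (fun A : Fin n → Fin 1 → ℝ => Real.exp (l * √(e + ∑ i, (A i 0) ^ 2))) (gaussMatrix n 1) := by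
    refine hint.mono' (Continuous.aestronglyMeasurable (by fun_prop)) (Filter.Eventually.of_forall fun A => ?_)
    rw [Real.norm_eq_abs, Real.abs_exp]; exact pt A
  refine ⟨hI, (integral_mono hI hint pt).trans ?_⟩
  rw [integral_const_mul, h2]
  have e3 : (√(1 - a))⁻¹ ≤ Real.exp (l / √n / 2) := by
    have : 1 - a = (1 + l / √n)⁻¹ := by rw [ha]; field_simp; ring
    rw [this, Real.sqrt_inv, inv_inv]
    apply Real.sqrt_le_iff.mpr ⟨by positivity, ?_⟩
    rw [← Real.exp_nat_mul]
    have := Real.add_one_le_exp (l / √n)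
    calc _ ≤ Real.exp (l / √n) := by linarith
      _ = _ := by congr 1; push_cast; ring
  have e4 : (√(1 - a))⁻¹ ^ n ≤ Real.exp (l * √n / 2) := by
    calc (√(1 - a))⁻¹ ^ n ≤ Real.exp (l / √n / 2) ^ n := by gcongr
      _ = Real.exp (l * √n / 2) := by
        rw [← Real.exp_nat_mul]
        congr 1
        have : (n:ℝ) = √n * √n := (Real.mul_self_sqrt (by positivity)).symm
        calc (n:ℝ) * (l / √n / 2) = (√n * √n) * (l / √n / 2) := by rw [← this]
          _ = _ := by field_simp
  calc _ ≤ Real.exp (a * e / 2 + l ^ 2 / (2 * a)) * Real.exp (l * √n / 2) := by gcongr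
    _ = Real.exp (a * e / 2) * Real.exp (l * √n + l ^ 2 / 2) := by
      rw [← Real.exp_add, ← Real.exp_add]; congr 1
      rw [ha]; field_simp; ring
    _ ≤ _ := by
      gcongr
      nlinarith

section linalg
variable {n j : ℕ} (B : Matrix (Fin n) (Fin j) ℝ) (e : ℝ)

/-- regularised Gram -/
noncomputable def W : Matrix (Fin j) (Fin j) ℝ := e • (1 : Matrix (Fin j) (Fin j) ℝ) + Bᵀ * B
/-- complementary quasi-projection -/
noncomputable def Q : Matrix (Fin n) (Fin n) ℝ := 1 - B * (W B e)⁻¹ * Bᵀ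

variable {e} (he : 0 < e)
include he

lemma W_pos : (W B e).PosDef := by
  unfold W
  refine Matrix.PosDef.add_posSemidef (Matrix.PosDef.one.smul he) ?_
  have := Matrix.posSemidef_conjTranspose_mul_self B
  rwa [conjTranspose_eq_transpose_of_trivial] at this

lemma W_det_pos : 0 < (W B e).det := (W_pos B he).det_pos

lemma W_unit : IsUnit (W B e).det := (W_det_pos B he).ne'.isUnit

lemma W_symm : (W B e)ᵀ = W B e := by
  unfold W; simp [transpose_mul]

lemma Q_symm : (Q B e)ᵀ = Q B e := by
  unfold Q
  rw [transpose_sub, transpose_mul, transpose_mul, transpose_transpose, transpose_nonsing_inv, W_symm B he,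
    transpose_one, Matrix.mul_assoc]

lemma Q_sub : Q B e - Q B e * Q B e = e • (((W B e)⁻¹ * Bᵀ)ᵀ * ((W B e)⁻¹ * Bᵀ)) := by
  have hb : Bᵀ * B = W B e - e • 1 := by unfold W; abel
  have h1 : Q B e - Q B e * Q B e = Q B e * (1 - Q B e) := by rw [Matrix.mul_sub, Matrix.mul_one]
  rw [h1]
  have h2 : 1 - Q B e = B * (W B e)⁻¹ * Bᵀ := by unfold Q; abel
  rw [h2]
  unfold Q
  rw [transpose_mul, transpose_nonsing_inv, W_symm B he, transpose_transpose, Matrix.sub_mul, Matrix.one_mul]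
  have h3 : B * (W B e)⁻¹ * Bᵀ * (B * (W B e)⁻¹ * Bᵀ) = B * (W B e)⁻¹ * (Bᵀ * B) * (W B e)⁻¹ * Bᵀ := by
    simp only [Matrix.mul_assoc]
  rw [h3, hb, Matrix.mul_sub, Matrix.sub_mul, Matrix.sub_mul]
  rw [Matrix.nonsing_inv_mul_cancel_right _ _ (W_unit B he)]
  rw [Matrix.mul_smul, Matrix.smul_mul, Matrix.smul_mul, Matrix.mul_one, sub_sub_cancel]
  simp only [Matrix.mul_assoc]

lemma Q_quad (a : Fin n → ℝ) : (Q B e *ᵥ a) ⬝ᵥ (Q B e *ᵥ a) ≤ a ⬝ᵥ (Q B e *ᵥ a) := by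
  have h : a ⬝ᵥ ((Q B e - Q B e * Q B e) *ᵥ a) = e * ((((W B e)⁻¹ * Bᵀ) *ᵥ a) ⬝ᵥ (((W B e)⁻¹ * Bᵀ) *ᵥ a)) := by
    rw [Q_sub B he, smul_mulVec, dotProduct_smul, ← mulVec_mulVec, dotProduct_mulVec, vecMul_transpose, smul_eq_mul]
  rw [sub_mulVec, dotProduct_sub, ← mulVec_mulVec] at h
  have h2 : a ⬝ᵥ (Q B e *ᵥ (Q B e *ᵥ a)) = (Q B e *ᵥ a) ⬝ᵥ (Q B e *ᵥ a) := by
    rw [dotProduct_mulVec, ← mulVec_transpose, Q_symm B he]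
  rw [h2] at h
  have h3 : 0 ≤ (((W B e)⁻¹ * Bᵀ) *ᵥ a) ⬝ᵥ (((W B e)⁻¹ * Bᵀ) *ᵥ a) := by
    unfold dotProduct; exact Finset.sum_nonneg fun i _ => mul_self_nonneg _
  nlinarith [mul_nonneg he.le h3]

lemma Q_trace : (n : ℝ) - j ≤ (Q B e).trace := by
  unfold Q
  have hb : Bᵀ * B = W B e - e • 1 := by unfold W; abel
  rw [trace_sub, Matrix.trace_mul_comm, ← Matrix.mul_assoc, hb, Matrix.sub_mul, Matrix.mul_nonsing_inv _ (W_unit B he)]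
  simp only [smul_mul, Matrix.one_mul, trace_sub, trace_smul, trace_one, Fintype.card_fin, smul_eq_mul]
  have := ((W_pos B he).inv).posSemidef.trace_nonneg
  nlinarith [mul_nonneg he.le this]

lemma Q_diag (i : Fin n) : 0 ≤ Q B e i i ∧ Q B e i i ≤ 1 := by
  have h := Q_quad B he (Pi.single i 1)
  simp only [mulVec_single_one, single_one_dotProduct] at h
  have h2 : (Q B e i i) * (Q B e i i) ≤ (Q B e).col i ⬝ᵥ (Q B e).col i := by
    unfold dotProduct
    exact Finset.single_le_sum (f := fun k => (Q B e).col i k * (Q B e).col i k) (fun k _ => mul_self_nonneg _) (Finset.mem_univ i)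
  have h3 : (Q B e).col i i = Q B e i i := rfl
  rw [h3] at h
  constructor <;> nlinarith

lemma W_det_succ (B' : Matrix (Fin n) (Fin (j+1)) ℝ) (a : Fin n → ℝ)
    (hB : ∀ i l, B' i (Fin.castSucc l) = B i l) (ha : ∀ i, B' i (Fin.last j) = a i) :
    (W B' e).det = (W B e).det * (e + a ⬝ᵥ (Q B e *ᵥ a)) := by
  have hr : (W B' e).submatrix (finSumFinEquiv (m := j) (n := 1)) (finSumFinEquiv (m := j) (n := 1)) =
      fromBlocks (W B e) (of fun l _ => (Bᵀ *ᵥ a) l) (of fun _ l => (Bᵀ *ᵥ a) l) (of fun _ _ => e + a ⬝ᵥ a) := by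
    have c1 : ∀ i l, B' i (Fin.castAdd 1 l) = B i l := hB
    have c2 : ∀ i (l : Fin 1), B' i (Fin.natAdd j l) = a i := by
      intro i l; rw [← ha]; congr 1; ext; simp
    have cne : ∀ (x : Fin j) (y : Fin 1), (Fin.castAdd 1 x : Fin (j+1)) ≠ Fin.natAdd j y := by
      intro x y h; have := congrArg Fin.val h; simp at this; have := x.2; omega
    ext x y
    rcases x with x | x <;> rcases y with y | y
    · simp [W, Matrix.mul_apply, c1, Matrix.one_apply]
    · simp [W, Matrix.mul_apply, c1, c2, mulVec, dotProduct, cne]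
    · simp [W, Matrix.mul_apply, c1, c2, mulVec, dotProduct, (cne _ _).symm, mul_comm]
    · simp [W, Matrix.mul_apply, c2, dotProduct, Subsingleton.elim x y]
  rw [← Matrix.det_submatrix_equiv_self (finSumFinEquiv (m := j) (n := 1)) (W B' e), hr]
  let _ := Matrix.invertibleOfIsUnitDet _ (W_unit B he)
  rw [Matrix.det_fromBlocks₁₁, Matrix.invOf_eq_nonsing_inv]
  congr 1
  rw [Matrix.det_fin_one]
  unfold Q
  rw [sub_mulVec, dotProduct_sub, one_mulVec]
  have : a ⬝ᵥ ((B * (W B e)⁻¹ * Bᵀ) *ᵥ a) = (Bᵀ *ᵥ a) ⬝ᵥ ((W B e)⁻¹ *ᵥ (Bᵀ *ᵥ a)) := by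
    rw [Matrix.mul_assoc, ← mulVec_mulVec, dotProduct_mulVec, ← mulVec_transpose, ← mulVec_mulVec]
  rw [this]
  generalize Bᵀ *ᵥ a = b
  rw [Matrix.sub_apply, of_apply, add_sub_assoc]
  congr 2
  rw [Matrix.mul_apply]
  simp only [Matrix.mul_apply, of_apply, dotProduct, mulVec, Finset.sum_mul, Finset.mul_sum]
  rw [Finset.sum_comm]
  exact Finset.sum_congr rfl fun x _ => Finset.sum_congr rfl fun y _ => by ring
end linalg
end RG

open MeasureTheory ProbabilityTheory Matrix
namespace RG

lemma quad_nonneg {n j : ℕ} (B : Matrix (Fin n) (Fin j) ℝ) {e : ℝ} (he : 0 < e) (a : Fin n → ℝ) :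
    0 ≤ a ⬝ᵥ (Q B e *ᵥ a) := by
  refine le_trans ?_ (Q_quad B he a)
  unfold dotProduct; exact Finset.sum_nonneg fun i _ => mul_self_nonneg _

lemma W_det_lower {n : ℕ} {e : ℝ} (he : 0 < e) : ∀ (j : ℕ) (B : Matrix (Fin n) (Fin j) ℝ), e ^ j ≤ (W B e).det := by
  intro j
  induction j with
  | zero => intro B; simp
  | succ j ih =>
    intro B'
    rw [W_det_succ (of fun i l => B' i (Fin.castSucc l)) he B' (fun i => B' i (Fin.last j)) (fun _ _ => rfl) (fun _ => rfl),
      pow_succ]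
    have h1 := ih (of fun i l => B' i (Fin.castSucc l))
    have h2 := quad_nonneg (of fun i l => B' i (Fin.castSucc l)) he (fun i => B' i (Fin.last j))
    have h3 := W_det_pos (of fun i l => B' i (Fin.castSucc l)) he
    exact mul_le_mul h1 (by linarith) he.le h3.le

/-- first `j` columns -/
def cols {n m : ℕ} (j : ℕ) (hj : j ≤ m) (A : Fin n → Fin m → ℝ) : Matrix (Fin n) (Fin j) ℝ :=
  of fun i l => A i (Fin.castLE hj l)

lemma continuous_cols {n m : ℕ} (j : ℕ) (hj : j ≤ m) : Continuous (cols (n := n) j hj) := by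
  unfold cols
  refine continuous_matrix fun i l => ?_
  simp only [of_apply]; fun_prop

lemma continuous_W {n m : ℕ} (j : ℕ) (hj : j ≤ m) (e : ℝ) :
    Continuous (fun A : Fin n → Fin m → ℝ => W (cols j hj A) e) := by
  unfold W
  have := continuous_cols (n := n) j hj
  exact continuous_const.add (this.matrix_transpose.matrix_mul this)

lemma continuous_Q {n m : ℕ} (j : ℕ) (hj : j ≤ m) (e : ℝ) (he : 0 < e) :
    Continuous (fun A : Fin n → Fin m → ℝ => Q (cols j hj A) e) := by
  unfold Q
  have h1 := continuous_cols (n := n) j hj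
  have h2 := continuous_W (n := n) j hj e
  have h3 : Continuous (fun A : Fin n → Fin m → ℝ => (W (cols j hj A) e)⁻¹) := by
    simp only [Matrix.inv_def, Ring.inverse_eq_inv']
    exact (h2.matrix_det.inv₀ (fun A => (W_det_pos _ he).ne')).smul h2.matrix_adjugate
  exact continuous_const.sub ((h1.matrix_mul h3).matrix_mul h1.matrix_transpose)

lemma young (k th V : ℝ) (hk : 1 ≤ k) (hth : 0 < th) (hV : 0 < V) :
    V * V ^ (-k) ≤ (1 - 1 / k) * th * V ^ (-k) + (1 / k) * (th * th ^ (-k)) := by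
  have hb := one_add_mul_self_le_rpow_one_add (s := V / th - 1) (p := k) (by have : 0 < V / th := by positivity
                                                                             linarith) hk
  rw [add_sub_cancel, Real.div_rpow hV.le hth.le] at hb
  rw [Real.rpow_neg hV.le, Real.rpow_neg hth.le]
  have p1 : 0 < V ^ k := by positivity
  have p2 : 0 < th ^ k := by positivity
  have hk0 : 0 < k := by linarith
  have : (1 + k * (V / th - 1)) * (th / (k * V ^ k)) ≤ V ^ k / th ^ k * (th / (k * V ^ k)) := by gcongr
  have e1 : V ^ k / th ^ k * (th / (k * V ^ k)) = 1 / k * (th * (th ^ k)⁻¹) := by field_simp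
  have e2 : (1 + k * (V / th - 1)) * (th / (k * V ^ k)) = V * (V ^ k)⁻¹ - (1 - 1 / k) * th * (V ^ k)⁻¹ := by
    field_simp; ring
  rw [e1, e2] at this
  linarith

lemma det_step {n m : ℕ} (j : ℕ) (hj : j + 1 ≤ m) (e k : ℝ) (he : 0 < e) (hk : 1 ≤ k)
    (hth : 0 < (n : ℝ) - j - 2 * k) :
    ∫ A, (W (cols (j + 1) hj A) e).det ^ (-k) ∂(gaussMatrix n m) ≤
      ((n : ℝ) - j - 2 * k) ^ (-k) * ∫ A, (W (cols j (Nat.le_of_succ_le hj) A) e).det ^ (-k) ∂(gaussMatrix n m) := by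
  set th := (n : ℝ) - j - 2 * k with hthd
  have hj' : j ≤ m := Nat.le_of_succ_le hj
  set jj : Fin m := ⟨j, hj⟩ with hjj
  set a : (Fin n → Fin m → ℝ) → Fin n → ℝ := fun A i => A i jj with ha
  set q : (Fin n → Fin m → ℝ) → Matrix (Fin n) (Fin n) ℝ := fun A => Q (cols j hj' A) e with hq
  set T : (Fin n → Fin m → ℝ) → ℝ := fun A => (W (cols j hj' A) e).det with hT
  set V : (Fin n → Fin m → ℝ) → ℝ := fun A => e + a A ⬝ᵥ (q A *ᵥ a A) with hV
  have hdet : ∀ A, (W (cols (j + 1) hj A) e).det = T A * V A := by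
    intro A
    exact W_det_succ (cols j hj' A) he (cols (j+1) hj A) (a A) (fun _ _ => rfl) (fun _ => rfl)
  have hVe : ∀ A, e ≤ V A := fun A => by
    have := quad_nonneg (cols j hj' A) he (a A)
    simp only [hV, hq]; linarith
  have hV0 : ∀ A, 0 < V A := fun A => he.trans_le (hVe A)
  have hTe : ∀ A, e ^ j ≤ T A := fun A => W_det_lower he j _
  have hT0 : ∀ A, 0 < T A := fun A => W_det_pos _ he
  have ca : Continuous a := by fun_prop
  have cq : Continuous q := continuous_Q j hj' e he
  have cT : Continuous T := (continuous_W j hj' e).matrix_det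
  have cqa : Continuous (fun A => q A *ᵥ a A) := cq.matrix_mulVec ca
  have cV : Continuous V := continuous_const.add (ca.dotProduct cqa)
  have cVk : ∀ r : ℝ, Continuous (fun A => V A ^ r) := fun r => cV.rpow_const (fun A => Or.inl (hV0 A).ne')
  have cTk : ∀ r : ℝ, Continuous (fun A => T A ^ r) := fun r => cT.rpow_const (fun A => Or.inl (hT0 A).ne')
  have cqai : ∀ i, Continuous (fun A => (q A *ᵥ a A) i) := fun i => (continuous_apply i).comp cqa
  have cqii : ∀ i, Continuous (fun A => q A i i) := fun i => cq.matrix_elem i i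
  have hk0 : 0 < k := by linarith
  -- bounds
  have bV : ∀ A, V A ^ (-k) ≤ e ^ (-k) := fun A => Real.rpow_le_rpow_of_nonpos he (hVe A) (by linarith)
  have bV1 : ∀ A, V A * V A ^ (-k) ≤ e * e ^ (-k) := fun A => by
    have h1 : V A * V A ^ (-k) = V A ^ (1 - k) := by
      rw [sub_eq_add_neg, Real.rpow_add (hV0 A), Real.rpow_one]
    have h2 : e * e ^ (-k) = e ^ (1 - k) := by
      rw [sub_eq_add_neg, Real.rpow_add he, Real.rpow_one]
    rw [h1, h2]; exact Real.rpow_le_rpow_of_nonpos he (hVe A) (by linarith)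
  have bT : ∀ A, T A ^ (-k) ≤ (e ^ j) ^ (-k) := fun A => Real.rpow_le_rpow_of_nonpos (by positivity) (hTe A) (by linarith)
  have pV : ∀ A, 0 < V A ^ (-k) := fun A => Real.rpow_pos_of_pos (hV0 A) _
  have pT : ∀ A, 0 < T A ^ (-k) := fun A => Real.rpow_pos_of_pos (hT0 A) _
  have pe : 0 < e ^ (-k) := by positivity
  set M := (e ^ (-k) + e * e ^ (-k)) * (e ^ j) ^ (-k) with hM
  have hqV : ∀ A, (q A *ᵥ a A) ⬝ᵥ (q A *ᵥ a A) ≤ V A := fun A => by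
    have := Q_quad (cols j hj' A) he (a A)
    simp only [hV, hq]; linarith
  have hqiV : ∀ A i, ((q A *ᵥ a A) i) ^ 2 ≤ V A := fun A i => by
    refine le_trans ?_ (hqV A)
    unfold dotProduct
    rw [sq]
    exact Finset.single_le_sum (f := fun i => (q A *ᵥ a A) i * (q A *ᵥ a A) i) (fun _ _ => mul_self_nonneg _) (Finset.mem_univ i)
  have hVm : ∀ A, V A ^ (-k - 1) * V A = V A ^ (-k) := fun A => by
    rw [Real.rpow_sub_one (hV0 A).ne', div_mul_cancel₀ _ (hV0 A).ne']
  -- fields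
  set F : Fin n → (Fin n → Fin m → ℝ) → ℝ := fun i A => (q A *ᵥ a A) i * V A ^ (-k) * T A ^ (-k) with hF
  set F' : Fin n → (Fin n → Fin m → ℝ) → ℝ := fun i A =>
    (q A i i * V A ^ (-k) + (q A *ᵥ a A) i * (2 * (q A *ᵥ a A) i * (-k) * V A ^ (-k - 1))) * T A ^ (-k) with hF'
  have bF : ∀ i A, |F i A| ≤ M := by
    intro i A
    simp only [hF, hM, abs_mul, abs_of_pos (pV A), abs_of_pos (pT A)]
    have h1 : |(q A *ᵥ a A) i| ≤ 1 + V A := by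
      rw [abs_le]; constructor <;> nlinarith [hqiV A i, sq_nonneg ((q A *ᵥ a A) i + 1), sq_nonneg ((q A *ᵥ a A) i - 1)]
    refine mul_le_mul ?_ (bT A) (pT A).le (by positivity)
    calc _ ≤ (1 + V A) * V A ^ (-k) := by
          have := (pV A).le
          gcongr
      _ = V A ^ (-k) + V A * V A ^ (-k) := by ring
      _ ≤ _ := add_le_add (bV A) (bV1 A)
  have bF' : ∀ i A, |F' i A| ≤ (1 + 2 * k) * M := by
    intro i A
    have hsq : (q A *ᵥ a A) i * (2 * (q A *ᵥ a A) i * (-k) * V A ^ (-k - 1)) = - (2 * k * (((q A *ᵥ a A) i) ^ 2 * V A ^ (-k - 1))) := by ring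
    have h1 : ((q A *ᵥ a A) i) ^ 2 * V A ^ (-k - 1) ≤ V A ^ (-k) := by
      rw [← hVm A, mul_comm]
      have := (Real.rpow_pos_of_pos (hV0 A) (-k-1)).le
      gcongr
      exact hqiV A i
    have h2 : 0 ≤ ((q A *ᵥ a A) i) ^ 2 * V A ^ (-k - 1) := mul_nonneg (sq_nonneg _) (Real.rpow_pos_of_pos (hV0 A) _).le
    obtain ⟨d0, d1⟩ := Q_diag (cols j hj' A) he i
    simp only [hF', hM, abs_mul _ (T A ^ (-k)), abs_of_pos (pT A), hsq]
    rw [← mul_assoc (1 + 2 * k)]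
    refine mul_le_mul ?_ (bT A) (pT A).le (by positivity)
    have h3 : 0 ≤ q A i i * V A ^ (-k) := mul_nonneg d0 (pV A).le
    have h4 : q A i i * V A ^ (-k) ≤ V A ^ (-k) := mul_le_of_le_one_left (pV A).le d1
    have h5 := bV A
    have h6 : 0 < e * e ^ (-k) := by positivity
    rw [abs_le]; constructor <;> nlinarith
  have mF : ∀ i, Measurable (F i) := fun i => (((cqai i).mul (cVk _)).mul (cTk _)).measurable
  have mF' : ∀ i, Measurable (F' i) := fun i => by
    refine Continuous.measurable ?_
    exact ((((cqii i).mul (cVk _)).add ((cqai i).mul (((continuous_const.mul (cqai i)).mul continuous_const).mul (cVk _))))).mul (cTk _)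
  have iF : ∀ i, Integrable (F i) (gaussMatrix n m) := fun i =>
    integrable_of_exp_bound _ (mF i) M 0 (by simpa using bF i)
  have iF' : ∀ i, Integrable (F' i) (gaussMatrix n m) := fun i =>
    integrable_of_exp_bound _ (mF' i) ((1 + 2 * k) * M) 0 (by simpa using bF' i)
  have iaF : ∀ i, Integrable (fun A => A i jj * F i A) (gaussMatrix n m) := fun i => by
    refine integrable_of_exp_bound _ (Measurable.mul (by fun_prop) (mF i)) M 1 (fun A => ?_)
    rw [abs_mul, mul_comm]
    refine mul_le_mul (bF i A) ?_ (abs_nonneg _) ((abs_nonneg _).trans (bF i A))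
    rw [one_mul]
    have := Real.add_one_le_exp (l1 A)
    linarith [abs_le_l1 A i jj]
  have hder : ∀ i A, HasLineDerivAt ℝ (F i) (F' i A) A (Pi.single i (Pi.single jj 1)) := by
    intro i A
    unfold HasLineDerivAt
    have hc : ∀ t : ℝ, cols j hj' (A + t • (Pi.single i (Pi.single jj 1) : Fin n → Fin m → ℝ)) = cols j hj' A := by
      intro t
      ext x l
      have : (Fin.castLE hj' l) ≠ jj := by
        intro h; have := congrArg Fin.val h; simp [hjj] at this; have := l.2; omega
      by_cases hx : x = i
      · subst hx; simp [cols, this]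
      · simp [cols, hx]
    have haa : ∀ t : ℝ, a (A + t • (Pi.single i (Pi.single jj 1) : Fin n → Fin m → ℝ)) = a A + t • Pi.single i 1 := by
      intro t
      ext x
      by_cases hx : x = i
      · subst hx; simp [ha]
      · simp [ha, hx]
    have hqq : ∀ t : ℝ, q (A + t • (Pi.single i (Pi.single jj 1) : Fin n → Fin m → ℝ)) = q A := fun t => by
      simp only [hq, hc]
    have hTT : ∀ t : ℝ, T (A + t • (Pi.single i (Pi.single jj 1) : Fin n → Fin m → ℝ)) = T A := fun t => by
      simp only [hT, hc]
    have hqa : ∀ t : ℝ, (q A *ᵥ (a A + t • Pi.single i 1)) i = (q A *ᵥ a A) i + t * q A i i := fun t => by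
      rw [mulVec_add, mulVec_smul, mulVec_single_one]; simp
    have hVV : ∀ t : ℝ, V (A + t • (Pi.single i (Pi.single jj 1) : Fin n → Fin m → ℝ)) = 
        V A + t * (2 * (q A *ᵥ a A) i) + t ^ 2 * q A i i := fun t => by
      simp only [hV, haa, hqq]
      have hs : a A ⬝ᵥ (q A *ᵥ (Pi.single i 1)) = (q A *ᵥ a A) i := by
        rw [dotProduct_mulVec, ← mulVec_transpose, Q_symm _ he]; simp; rfl
      rw [mulVec_add, mulVec_smul, add_dotProduct, dotProduct_add, dotProduct_add, dotProduct_smul, smul_dotProduct, smul_dotProduct,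
        dotProduct_smul, hs]
      simp [mulVec_single_one]
      ring
    have d1 : HasDerivAt (fun t : ℝ => (q A *ᵥ a A) i + t * q A i i) (1 * q A i i) 0 :=
      ((hasDerivAt_id (0:ℝ)).mul_const _).const_add _
    have d2 : HasDerivAt (fun t : ℝ => V A + t * (2 * (q A *ᵥ a A) i) + t ^ 2 * q A i i) (2 * (q A *ᵥ a A) i) 0 := by
      have h1 := (((hasDerivAt_id (0:ℝ)).mul_const (2 * (q A *ᵥ a A) i)).const_add (V A)).add (((hasDerivAt_id (0:ℝ)).pow 2).mul_const (q A i i))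
      convert! h1 using 1
      simp
    have d3 := d2.rpow_const (p := -k) (Or.inl (by simp; exact (hV0 A).ne'))
    have d4 := (d1.mul d3).mul_const (T A ^ (-k))
    have heq : (fun t : ℝ => F i (A + t • (Pi.single i (Pi.single jj 1) : Fin n → Fin m → ℝ))) =
      fun t => ((q A *ᵥ a A) i + t * q A i i) * (V A + t * (2 * (q A *ᵥ a A) i) + t ^ 2 * q A i i) ^ (-k) * T A ^ (-k) := by
      ext t
      simp only [hF, hqq, haa, hTT, hVV, hqa]
    rw [heq]
    convert! d4 using 1
    simp [hF']
  have hst : ∀ i, ∫ A, A i jj * F i A ∂(gaussMatrix n m) = ∫ A, F' i A ∂(gaussMatrix n m) := fun i =>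
    stein_mat n m i jj (F i) (F' i) (hder i) (iF i) (iF' i) (iaF i)
  have hsum : ∫ A, ∑ i, A i jj * F i A ∂(gaussMatrix n m) = ∫ A, ∑ i, F' i A ∂(gaussMatrix n m) := by
    rw [integral_finsetSum _ (fun i _ => iaF i), integral_finsetSum _ (fun i _ => iF' i)]
    exact Finset.sum_congr rfl fun i _ => hst i
  have iT : Integrable (fun A => T A ^ (-k)) (gaussMatrix n m) :=
    integrable_of_exp_bound _ (cTk _).measurable ((e ^ j) ^ (-k)) 0 (by intro A; rw [abs_of_pos (pT A)]; simpa using bT A)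
  have iTV : Integrable (fun A => V A ^ (-k) * T A ^ (-k)) (gaussMatrix n m) :=
    integrable_of_exp_bound _ ((cVk _).mul (cTk _)).measurable (e ^ (-k) * (e ^ j) ^ (-k)) 0 
      (by intro A; rw [abs_of_pos (mul_pos (pV A) (pT A))]; simpa using mul_le_mul (bV A) (bT A) (pT A).le pe.le)
  have up : ∫ A, ∑ i, A i jj * F i A ∂(gaussMatrix n m) ≤
      ∫ A, ((1 - 1 / k) * th * (V A ^ (-k) * T A ^ (-k)) + (1 / k) * (th * th ^ (-k)) * T A ^ (-k)) ∂(gaussMatrix n m) := by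
    refine integral_mono (integrable_finsetSum _ fun i _ => iaF i) ((iTV.const_mul _).add (iT.const_mul _)) fun A => ?_
    have h1 : ∑ i, A i jj * F i A = (V A - e) * V A ^ (-k) * T A ^ (-k) := by
      have e1 : V A - e = ∑ i, a A i * (q A *ᵥ a A) i := by
        simp only [hV, add_sub_cancel_left]; rfl
      rw [e1, Finset.sum_mul, Finset.sum_mul]
      exact Finset.sum_congr rfl fun i _ => by simp only [hF, mul_assoc]; rfl
    simp only [h1]
    have h2 := young k th (V A) hk hth (hV0 A)
    calc (V A - e) * V A ^ (-k) * T A ^ (-k) ≤ V A * V A ^ (-k) * T A ^ (-k) := by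
          have := pV A; have := pT A
          gcongr; linarith
      _ ≤ ((1 - 1 / k) * th * V A ^ (-k) + (1 / k) * (th * th ^ (-k))) * T A ^ (-k) := by
          have := pT A
          gcongr
      _ = _ := by ring
  have low : ∫ A, th * (V A ^ (-k) * T A ^ (-k)) ∂(gaussMatrix n m) ≤ ∫ A, ∑ i, F' i A ∂(gaussMatrix n m) := by
    refine integral_mono (iTV.const_mul _) (integrable_finsetSum _ fun i _ => iF' i) fun A => ?_
    have h1 : ∑ i, F' i A = ((q A).trace * V A ^ (-k) - 2 * k * (((q A *ᵥ a A) ⬝ᵥ (q A *ᵥ a A)) * V A ^ (-k - 1))) * T A ^ (-k) := by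
      simp only [hF']
      have e1 : (q A).trace * V A ^ (-k) = ∑ i, q A i i * V A ^ (-k) := by
        rw [Matrix.trace, Finset.sum_mul]; rfl
      have e2 : 2 * k * (((q A *ᵥ a A) ⬝ᵥ (q A *ᵥ a A)) * V A ^ (-k - 1)) =
          ∑ i, 2 * k * (((q A *ᵥ a A) i * (q A *ᵥ a A) i) * V A ^ (-k - 1)) := by
        rw [dotProduct, Finset.sum_mul, Finset.mul_sum]
      rw [e1, e2, ← Finset.sum_sub_distrib, Finset.sum_mul]
      exact Finset.sum_congr rfl fun i _ => by ring
    simp only [h1]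
    rw [← mul_assoc]
    have ht := Q_trace (cols j hj' A) he
    have h2 : ((q A *ᵥ a A) ⬝ᵥ (q A *ᵥ a A)) * V A ^ (-k - 1) ≤ V A ^ (-k) := by
      rw [← hVm A, mul_comm]
      have := (Real.rpow_pos_of_pos (hV0 A) (-k-1)).le
      gcongr
      exact hqV A
    have := pT A
    gcongr
    have h3 : ((n:ℝ) - j) * V A ^ (-k) ≤ (q A).trace * V A ^ (-k) := by
      have := pV A
      gcongr
    rw [hthd]
    nlinarith
  rw [← hsum] at low
  have fin := low.trans up
  rw [integral_add (iTV.const_mul _) (iT.const_mul _), integral_const_mul, integral_const_mul, integral_const_mul] at fin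
  have hgoal : ∫ A, (W (cols (j + 1) hj A) e).det ^ (-k) ∂(gaussMatrix n m) = ∫ A, V A ^ (-k) * T A ^ (-k) ∂(gaussMatrix n m) := by
    congr 1; ext A
    rw [hdet, Real.mul_rpow (hT0 A).le (hV0 A).le, mul_comm]
  rw [hgoal]
  set I1 := ∫ A, V A ^ (-k) * T A ^ (-k) ∂(gaussMatrix n m)
  set I2 := ∫ A, T A ^ (-k) ∂(gaussMatrix n m)
  have h7 : th / k * I1 ≤ th / k * (th ^ (-k) * I2) := by
    have e1 : th / k * I1 = th * I1 - (1 - 1 / k) * th * I1 := by field_simp; ring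
    have e2 : th / k * (th ^ (-k) * I2) = 1 / k * (th * th ^ (-k)) * I2 := by field_simp
    rw [e1, e2]; linarith
  exact le_of_mul_le_mul_left h7 (by positivity)

lemma det_moment {n m : ℕ} (e k : ℝ) (he : 0 < e) (hk : 1 ≤ k) : ∀ (j : ℕ) (hj : j ≤ m) (_ : 0 < (n : ℝ) - (j - 1) - 2 * k),
    ∫ A, (W (cols j hj A) e).det ^ (-k) ∂(gaussMatrix n m) ≤ ∏ i ∈ Finset.range j, ((n : ℝ) - i - 2 * k) ^ (-k) := by
  intro j
  induction j with
  | zero => intro hj _; simp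
  | succ j ih =>
    intro hj h
    push_cast at h
    have h' : 0 < (n:ℝ) - j - 2 * k := by linarith
    refine (det_step j hj e k he hk h').trans ?_
    rw [Finset.prod_range_succ, mul_comm]
    gcongr
    exact ih _ (by linarith)

end RG

open MeasureTheory ProbabilityTheory Matrix
namespace RG

section gordon
variable {ι κ : Type*} [Fintype ι] [Fintype κ]

/-- partition function -/
noncomputable def SS (H : (κ → ℝ) → ℝ) (L : ℝ) (y : ι → κ → ℝ) : ℝ := ∑ u, Real.exp (L * H (y u))

lemma SS_deriv (H : (κ → ℝ) → ℝ) (G : (κ → ℝ) → κ → ℝ)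
    (hH : ∀ y, HasFDerivAt H (∑ c, G y c • (ContinuousLinearMap.proj c : (κ → ℝ) →L[ℝ] ℝ)) y) (L : ℝ)
    (y : ι → ℝ → κ → ℝ) (v : ι → κ → ℝ) (t : ℝ) (hy : ∀ u, HasDerivAt (y u) (v u) t) :
    HasDerivAt (fun s => SS H L (fun u => y u s))
      (∑ u, Real.exp (L * H (y u t)) * (L * ∑ c, G (y u t) c * v u c)) t := by
  unfold SS
  refine HasDerivAt.fun_sum fun u _ => ?_
  have h1 := (hH (y u t)).comp_hasDerivAt t (hy u)
  have h2 : HasDerivAt (fun s => H (y u s)) (∑ c, G (y u t) c * v u c) t := by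
    convert! h1 using 1
    simp
  exact (h2.const_mul L).exp

lemma gordon_abs [Nonempty ι] {V : Type*} [NormedAddCommGroup V] [NormedSpace ℝ V] [FiniteDimensional ℝ V]
    [MeasureSpace V] [BorelSpace V] [(volume : Measure V).IsAddHaarMeasure]
    {μ : Measure V} [IsProbabilityMeasure μ] {q : V → ℝ} (hμ : GD μ q) (hexp : ∀ c : ℝ, Integrable (fun x => Real.exp (c * ‖x‖)) μ)
    (q' : V → V →L[ℝ] ℝ) (hq : ∀ x, HasFDerivAt q (q' x) x)
    (a b : ι → κ → V →L[ℝ] ℝ) (da db : ι → κ → V)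
    (hda : ∀ u c x, q' x (da u c) = 2 * a u c x) (hdb : ∀ u c x, q' x (db u c) = 2 * b u c x)
    (hab : ∀ u c u' c', a u' c' (db u c) = 0) (hba : ∀ u c u' c', b u' c' (da u c) = 0)
    (ε : κ → ℝ) (K : ι → ι → ℝ) (hK0 : ∀ u, K u u = 0) (hK : ∀ u u', 0 ≤ K u u')
    (hcov : ∀ u u' c, a u' c (da u c) - b u' c (db u c) = ε c * K u u')
    (hcov' : ∀ u u' c c', c ≠ c' → a u' c' (da u c) = 0 ∧ b u' c' (db u c) = 0)
    (H : (κ → ℝ) → ℝ) (G : (κ → ℝ) → κ → ℝ)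
    (hH : ∀ y, HasFDerivAt H (∑ c, G y c • (ContinuousLinearMap.proj c : (κ → ℝ) →L[ℝ] ℝ)) y)
    (hGc : Continuous G) (hG : ∀ y c, |G y c| ≤ 1) (C0 : ℝ) (hHb : ∀ y, |H y| ≤ C0 + ∑ c, |y c|)
    (hGG : ∀ y y', 0 ≤ ∑ c, ε c * (G y c * G y' c))
    (L p : ℝ) (hL : 0 < L) (hp : 0 < p) (hp1 : p ≤ 1) :
    ∫ x, SS H L (fun u c => a u c x) ^ p ∂μ ≤ ∫ x, SS H L (fun u c => b u c x) ^ p ∂μ := by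
  classical
  set Y : ι → ℝ → V → κ → ℝ := fun u α x c => Real.sin α * a u c x + Real.cos α * b u c x with hY
  set D : ι → ℝ → V → κ → ℝ := fun u α x c => Real.cos α * a u c x - Real.sin α * b u c x with hD
  set S : ℝ → V → ℝ := fun α x => SS H L (fun u => Y u α x) with hS
  have cH : Continuous H := continuous_iff_continuousAt.2 fun y => (hH y).continuousAt
  have cY : ∀ u α, Continuous (Y u α) := fun u α => by
    refine continuous_pi fun c => ?_
    exact (continuous_const.mul (a u c).continuous).add (continuous_const.mul (b u c).continuous)
  have cE : ∀ u α, Continuous (fun x => Real.exp (L * H (Y u α x))) := fun u α =>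
    Real.continuous_exp.comp (continuous_const.mul (cH.comp (cY u α)))
  have cS : ∀ α, Continuous (S α) := fun α => by
    simp only [hS, SS]
    exact continuous_finsetSum _ fun u _ => cE u α
  have hS0 : ∀ α x, 0 < S α x := fun α x => by
    simp only [hS, SS]
    exact Finset.sum_pos (fun _ _ => Real.exp_pos _) Finset.univ_nonempty
  have cSp : ∀ α (r : ℝ), Continuous (fun x => S α x ^ r) := fun α r => (cS α).rpow_const fun x => Or.inl (hS0 α x).ne'
  have cG : ∀ u α c, Continuous (fun x => G (Y u α x) c) := fun u α c =>
    (continuous_apply c).comp (hGc.comp (cY u α))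
  have cD : ∀ u α c, Continuous (fun x => D u α x c) := fun u α c =>
    (continuous_const.mul (a u c).continuous).sub (continuous_const.mul (b u c).continuous)
  -- bounds
  set B : ℝ := ∑ u, ∑ c, (‖a u c‖ + ‖b u c‖) with hB
  have hB0 : 0 ≤ B := by positivity
  have hBle : ∀ u c, ‖a u c‖ + ‖b u c‖ ≤ B := fun u c =>
    (Finset.single_le_sum (f := fun c => ‖a u c‖ + ‖b u c‖) (fun _ _ => by positivity) (Finset.mem_univ c)).trans
      (Finset.single_le_sum (f := fun u => ∑ c, (‖a u c‖ + ‖b u c‖)) (fun _ _ => by positivity) (Finset.mem_univ u))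
  have hab1 : ∀ u c x, |a u c x| + |b u c x| ≤ B * ‖x‖ := fun u c x => by
    have h1 := (a u c).le_opNorm x
    have h2 := (b u c).le_opNorm x
    rw [Real.norm_eq_abs] at h1 h2
    have := mul_le_mul_of_nonneg_right (hBle u c) (norm_nonneg x)
    linarith
  have hYb : ∀ u α x c, |Y u α x c| ≤ B * ‖x‖ := fun u α x c => by
    refine le_trans ?_ (hab1 u c x)
    refine (abs_add_le _ _).trans (add_le_add ?_ ?_) <;> rw [abs_mul]
    · exact mul_le_of_le_one_left (abs_nonneg _) (Real.abs_sin_le_one α)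
    · exact mul_le_of_le_one_left (abs_nonneg _) (Real.abs_cos_le_one α)
  have hDb : ∀ u α x c, |D u α x c| ≤ B * ‖x‖ := fun u α x c => by
    refine le_trans ?_ (hab1 u c x)
    refine (abs_sub _ _).trans (add_le_add ?_ ?_) <;> rw [abs_mul]
    · exact mul_le_of_le_one_left (abs_nonneg _) (Real.abs_cos_le_one α)
    · exact mul_le_of_le_one_left (abs_nonneg _) (Real.abs_sin_le_one α)
  set R : V → ℝ := fun x => C0 + Fintype.card κ * B * ‖x‖ with hR
  have hHY : ∀ u α x, |H (Y u α x)| ≤ R x := fun u α x => by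
    refine (hHb _).trans ?_
    simp only [hR]
    have := Finset.sum_le_card_nsmul Finset.univ (fun c => |Y u α x c|) _ (fun c _ => hYb u α x c)
    simp only [Finset.card_univ, nsmul_eq_mul] at this
    linarith
  have hEu : ∀ u α x, Real.exp (L * H (Y u α x)) ≤ Real.exp (L * R x) := fun u α x => by
    have := (abs_le.1 (hHY u α x)).2
    gcongr
  have hEl : ∀ u α x, Real.exp (-(L * R x)) ≤ Real.exp (L * H (Y u α x)) := fun u α x => by
    have := (abs_le.1 (hHY u α x)).1
    apply Real.exp_le_exp.2; nlinarith
  have hR0 : ∀ x, 0 ≤ R x := fun x => by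
    obtain ⟨u⟩ := ‹Nonempty ι›
    exact (abs_nonneg _).trans (hHY u 0 x)
  have hSl : ∀ α x, Real.exp (-(L * R x)) ≤ S α x := fun α x => by
    obtain ⟨u⟩ := ‹Nonempty ι›
    refine (hEl u α x).trans ?_
    exact Finset.single_le_sum (f := fun u => Real.exp (L * H (Y u α x))) (fun _ _ => (Real.exp_pos _).le) (Finset.mem_univ u)
  have hSr : ∀ r : ℝ, -2 ≤ r → r ≤ 0 → ∀ α x, S α x ^ r ≤ Real.exp (2 * (L * R x)) := fun r h2 h0 α x => by
    refine (Real.rpow_le_rpow_of_nonpos (Real.exp_pos _) (hSl α x) h0).trans ?_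
    rw [← Real.exp_mul]
    have := mul_nonneg hL.le (hR0 x)
    apply Real.exp_le_exp.2; nlinarith
  set N : ℝ := ((Fintype.card ι : ℕ) : ℝ) with hN
  have hN1 : 1 ≤ N := by simp only [hN]; exact_mod_cast Fintype.card_pos
  have hSu : ∀ α x, S α x ≤ N * Real.exp (L * R x) := fun α x => by
    have := Finset.sum_le_card_nsmul Finset.univ (fun u => Real.exp (L * H (Y u α x))) _ (fun u _ => hEu u α x)
    simp only [Finset.card_univ, nsmul_eq_mul] at this
    exact this
  have hSp : ∀ α x, S α x ^ p ≤ N * Real.exp (L * R x) := fun α x => by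
    refine (Real.rpow_le_rpow (hS0 α x).le (hSu α x) hp.le).trans ?_
    refine (Real.rpow_le_rpow_of_exponent_le ?_ hp1).trans (by rw [Real.rpow_one])
    have := Real.one_le_exp (mul_nonneg hL.le (hR0 x))
    nlinarith
  -- integrability criterion
  have hint : ∀ (f : V → ℝ) (C c : ℝ), Continuous f → (∀ x, |f x| ≤ C * (Real.exp (c * (L * R x)) * Real.exp ‖x‖)) → Integrable f μ := by
    intro f C c hf hb
    refine ((hexp (c * L * Fintype.card κ * B + 1)).const_mul (C * Real.exp (c * L * C0))).mono' hf.aestronglyMeasurable (Filter.Eventually.of_forall fun x => ?_)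
    refine (hb x).trans (le_of_eq ?_)
    rw [mul_assoc, ← Real.exp_add, ← Real.exp_add]
    congr 2
    simp only [hR]; ring
  have hxe : ∀ x : V, ‖x‖ ≤ Real.exp ‖x‖ := fun x => by linarith [Real.add_one_le_exp ‖x‖]
  have hxe1 : ∀ x : V, 1 ≤ Real.exp ‖x‖ := fun x => Real.one_le_exp (norm_nonneg x)
  -- derivative in α
  set Φ' : ℝ → V → ℝ := fun α x => p * L * ∑ u, ∑ c, D u α x c * (S α x ^ (p - 1) * Real.exp (L * H (Y u α x)) * G (Y u α x) c) with hΦ'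
  have hfb : ∀ u c α x, |S α x ^ (p - 1) * Real.exp (L * H (Y u α x)) * G (Y u α x) c| ≤ Real.exp (3 * (L * R x)) := by
    intro u c α x
    rw [abs_mul, abs_mul, Real.abs_exp, abs_of_pos (Real.rpow_pos_of_pos (hS0 α x) _)]
    calc _ ≤ Real.exp (2 * (L * R x)) * Real.exp (L * R x) * 1 := by
          refine mul_le_mul (mul_le_mul (hSr _ (by linarith) (by linarith) α x) (hEu u α x) (Real.exp_pos _).le (Real.exp_pos _).le) (hG _ _) (abs_nonneg _) (by positivity)
      _ = _ := by rw [mul_one, ← Real.exp_add]; congr 1; ring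
  have hDfb : ∀ u c α x, |D u α x c * (S α x ^ (p - 1) * Real.exp (L * H (Y u α x)) * G (Y u α x) c)| ≤ B * (Real.exp (3 * (L * R x)) * Real.exp ‖x‖) := by
    intro u c α x
    rw [abs_mul]
    calc _ ≤ (B * ‖x‖) * Real.exp (3 * (L * R x)) := mul_le_mul (hDb u α x c) (hfb u c α x) (abs_nonneg _) (by positivity)
      _ ≤ (B * Real.exp ‖x‖) * Real.exp (3 * (L * R x)) := by gcongr; exact hxe x
      _ = _ := by ring
  set CC : ℝ := p * L * (N * (Fintype.card κ * B)) with hCC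
  have hΦb : ∀ α x, |Φ' α x| ≤ CC * (Real.exp (3 * (L * R x)) * Real.exp ‖x‖) := by
    intro α x
    simp only [hΦ', abs_mul, abs_of_pos hp, abs_of_pos hL, hCC]
    rw [mul_assoc (p * L)]
    gcongr
    refine (Finset.abs_sum_le_sum_abs _ _).trans ?_
    refine (Finset.sum_le_card_nsmul _ _ ((Fintype.card κ * B) * (Real.exp (3 * (L * R x)) * Real.exp ‖x‖)) (fun u _ => ?_)).trans (by
      simp only [Finset.card_univ, nsmul_eq_mul, hN]; rw [mul_assoc, mul_assoc, mul_assoc])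
    refine (Finset.abs_sum_le_sum_abs _ _).trans ?_
    refine (Finset.sum_le_card_nsmul _ _ (B * (Real.exp (3 * (L * R x)) * Real.exp ‖x‖)) (fun c _ => hDfb u c α x)).trans (by
      simp only [Finset.card_univ, nsmul_eq_mul]; rw [mul_assoc])
  have hder : ∀ α x, HasDerivAt (fun α => S α x ^ p) (Φ' α x) α := by
    intro α x
    have h1 : ∀ u, HasDerivAt (fun α => Y u α x) (D u α x) α := by
      intro u
      rw [hasDerivAt_pi]
      intro c
      have := ((Real.hasDerivAt_sin α).mul_const (a u c x)).add ((Real.hasDerivAt_cos α).mul_const (b u c x))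
      convert! this using 1
      simp only [hD]; ring
    have h2 := SS_deriv H G hH L (fun u α => Y u α x) (fun u => D u α x) α h1
    have h3 := h2.rpow_const (p := p) (Or.inl (hS0 α x).ne')
    convert! h3 using 1
    simp only [hΦ', Finset.sum_mul, Finset.mul_sum]
    refine Finset.sum_congr rfl fun u _ => Finset.sum_congr rfl fun c _ => ?_
    simp only [hS]; ring
  have ibound : Integrable (fun x => CC * (Real.exp (3 * (L * R x)) * Real.exp ‖x‖)) μ := by
    refine hint _ CC 3 ?_ fun x => ?_
    · simp only [hR]; fun_prop
    · rw [abs_of_nonneg]; positivity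
  have iSp : ∀ α, Integrable (fun x => S α x ^ p) μ := fun α => by
    refine hint _ N 1 (cSp α p) fun x => ?_
    rw [abs_of_pos (Real.rpow_pos_of_pos (hS0 α x) _), one_mul]
    refine (hSp α x).trans ?_
    have := hxe1 x
    have h := Real.exp_pos (L * R x)
    gcongr
    nlinarith
  have cf : ∀ u c α, Continuous (fun x => S α x ^ (p - 1) * Real.exp (L * H (Y u α x)) * G (Y u α x) c) := fun u c α =>
    ((cSp α _).mul (cE u α)).mul (cG u α c)
  have cΦ : ∀ α, Continuous (Φ' α) := fun α =>
    continuous_const.mul (continuous_finsetSum _ fun u _ => continuous_finset_sum _ fun c _ => (cD u α c).mul (cf u c α))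
  have hφ : ∀ α, HasDerivAt (fun α => ∫ x, S α x ^ p ∂μ) (∫ x, Φ' α x ∂μ) α := by
    intro α
    exact (hasDerivAt_integral_of_dominated_loc_of_deriv_le (s := Set.univ) Filter.univ_mem
      (Filter.Eventually.of_forall fun α => (cSp α p).aestronglyMeasurable) (iSp α) (cΦ α).aestronglyMeasurable
      (bound := fun x => CC * (Real.exp (3 * (L * R x)) * Real.exp ‖x‖))
      (Filter.Eventually.of_forall fun x α _ => hΦb α x) ibound
      (Filter.Eventually.of_forall fun x α _ => hder α x)).2
  -- Stein
  set f' : ι → κ → ℝ → V → ℝ := fun u c α x => 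
    (∑ u', Real.exp (L * H (Y u' α x)) * (L * (G (Y u' α x) c * (Real.sin α * Real.cos α * (ε c * K u u'))))) * (p - 1) * S α x ^ (p - 1 - 1)
      * Real.exp (L * H (Y u α x)) * G (Y u α x) c with hf'
  have cf' : ∀ u c α, Continuous (f' u c α) := fun u c α => by
    simp only [hf']
    refine Continuous.mul (Continuous.mul (Continuous.mul (Continuous.mul ?_ continuous_const) (cSp α _)) (cE u α)) (cG u α c)
    exact continuous_finsetSum _ fun u' _ => (cE u' α).mul (continuous_const.mul ((cG u' α c).mul continuous_const))
  have hline : ∀ u c α x, HasLineDerivAt ℝ (fun x => S α x ^ (p - 1) * Real.exp (L * H (Y u α x)) * G (Y u α x) c)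
      (f' u c α x) x (Real.cos α • da u c - Real.sin α • db u c) := by
    intro u c α x
    set d := Real.cos α • da u c - Real.sin α • db u c with hd
    have hYd : ∀ u' (t : ℝ), Y u' α (x + t • d) = Y u' α x + t • (Pi.single c (Real.sin α * Real.cos α * (ε c * K u u')) : κ → ℝ) := by
      intro u' t
      ext c'
      simp only [hY, hd, map_add, map_smul, map_sub, hab, hba, smul_eq_mul, Pi.add_apply, Pi.smul_apply]
      by_cases hc : c = c'
      · subst hc
        rw [Pi.single_eq_same, ← hcov]; ring
      · obtain ⟨h1, h2⟩ := hcov' u u' c c' hc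
        rw [Pi.single_eq_of_ne (Ne.symm hc), h1, h2]; ring
    have hYu : ∀ t : ℝ, Y u α (x + t • d) = Y u α x := fun t => by
      rw [hYd, hK0]; simp
    unfold HasLineDerivAt
    simp only [hYu]
    have h1 := SS_deriv H G hH L (fun u' (t : ℝ) => Y u' α x + t • (Pi.single c (Real.sin α * Real.cos α * (ε c * K u u')) : κ → ℝ))
      (fun u' => (Pi.single c (Real.sin α * Real.cos α * (ε c * K u u')) : κ → ℝ)) 0 (fun u' => by
        simpa using ((hasDerivAt_id (0:ℝ)).smul_const (Pi.single c (Real.sin α * Real.cos α * (ε c * K u u')) : κ → ℝ)).const_add (Y u' α x))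
    have h2 : HasDerivAt (fun t : ℝ => S α (x + t • d)) (∑ u', Real.exp (L * H (Y u' α x)) * (L * (G (Y u' α x) c * (Real.sin α * Real.cos α * (ε c * K u u'))))) 0 := by
      convert! h1 using 1
      · ext t; simp only [hS, hYd]
      · refine Finset.sum_congr rfl fun u' _ => ?_
        rw [zero_smul, add_zero]
        congr 2
        rw [Finset.sum_eq_single c]
        · simp
        · intro c' _ hc; simp [hc]
        · simp
    have h3 := h2.rpow_const (p := p - 1) (Or.inl (by simpa using (hS0 α x).ne'))
    have h4 := (h3.mul_const (Real.exp (L * H (Y u α x)))).mul_const (G (Y u α x) c)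
    convert! h4 using 1
    simp [hf']
  have hqd : ∀ u c α x, HasLineDerivAt ℝ q (2 * D u α x c) x (Real.cos α • da u c - Real.sin α • db u c) := by
    intro u c α x
    have := (hq x).hasLineDerivAt (Real.cos α • da u c - Real.sin α • db u c)
    convert! this using 1
    simp only [map_sub, map_smul, hda, hdb, hD, smul_eq_mul]; ring
  have ifi : ∀ u c α, Integrable (fun x => S α x ^ (p - 1) * Real.exp (L * H (Y u α x)) * G (Y u α x) c) μ := fun u c α => by
    refine hint _ 1 3 (cf u c α) fun x => (hfb u c α x).trans ?_
    have := hxe1 x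
    have := Real.exp_pos (3 * (L * R x))
    nlinarith
  have iDf : ∀ u c α, Integrable (fun x => D u α x c * (S α x ^ (p - 1) * Real.exp (L * H (Y u α x)) * G (Y u α x) c)) μ := fun u c α =>
    hint _ B 3 ((cD u α c).mul (cf u c α)) fun x => hDfb u c α x
  have if' : ∀ u c α, Integrable (f' u c α) μ := fun u c α => by
    set Z : ℝ := ∑ u', |L * (Real.sin α * Real.cos α * (ε c * K u u'))| with hZ
    have hZ0 : 0 ≤ Z := by positivity
    refine hint _ (Z * |p - 1|) 4 (cf' u c α) fun x => ?_
    simp only [hf', abs_mul, Real.abs_exp, abs_of_pos (Real.rpow_pos_of_pos (hS0 α x) _)]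
    have h1 : |∑ u', Real.exp (L * H (Y u' α x)) * (L * (G (Y u' α x) c * (Real.sin α * Real.cos α * (ε c * K u u'))))| ≤ Real.exp (L * R x) * Z := by
      refine (Finset.abs_sum_le_sum_abs _ _).trans ?_
      rw [hZ, Finset.mul_sum]
      refine Finset.sum_le_sum fun u' _ => ?_
      rw [abs_mul, Real.abs_exp]
      refine mul_le_mul (hEu u' α x) ?_ (abs_nonneg _) (Real.exp_pos _).le
      rw [abs_mul, abs_mul L, abs_mul]
      refine mul_le_mul_of_nonneg_left ?_ (abs_nonneg _)
      exact mul_le_of_le_one_left (abs_nonneg _) (hG _ _)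
    calc _ ≤ (Real.exp (L * R x) * Z) * |p - 1| * Real.exp (2 * (L * R x)) * Real.exp (L * R x) * 1 := by
          have := hG (Y u α x) c
          have := hEu u α x
          have := hSr (p - 1 - 1) (by linarith) (by linarith) α x
          have := (Real.rpow_pos_of_pos (hS0 α x) (p - 1 - 1)).le
          gcongr
      _ = Z * |p - 1| * (Real.exp (L * R x) * Real.exp (2 * (L * R x)) * Real.exp (L * R x)) := by ring
      _ = Z * |p - 1| * Real.exp (4 * (L * R x)) := by rw [← Real.exp_add, ← Real.exp_add]; congr 2; ring
      _ ≤ _ := by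
        have := hxe1 x
        have := Real.exp_pos (4 * (L * R x))
        gcongr
        nlinarith
  have hst : ∀ α, ∫ x, Φ' α x ∂μ = p * L * ∫ x, ∑ u, ∑ c, f' u c α x ∂μ := by
    intro α
    simp only [hΦ']
    rw [integral_const_mul, integral_finsetSum _ (fun u _ => integrable_finsetSum _ fun c _ => iDf u c α),
      integral_finsetSum _ (fun u _ => integrable_finsetSum _ fun c _ => if' u c α)]
    congr 1
    refine Finset.sum_congr rfl fun u _ => ?_
    rw [integral_finsetSum _ fun c _ => iDf u c α, integral_finsetSum _ fun c _ => if' u c α]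
    refine Finset.sum_congr rfl fun c _ => ?_
    exact hμ.stein _ (fun x => D u α x c) (hqd u c α) _ _ (hline u c α) (ifi u c α) (if' u c α) (iDf u c α)
  have hneg : ∀ α, 0 ≤ Real.sin α * Real.cos α → ∫ x, Φ' α x ∂μ ≤ 0 := by
    intro α hα
    rw [hst]
    refine mul_nonpos_of_nonneg_of_nonpos (by positivity) (integral_nonpos fun x => ?_)
    have key : ∑ u, ∑ c, f' u c α x = ∑ u, ∑ u', (p - 1) * (S α x ^ (p - 1 - 1) * Real.exp (L * H (Y u α x)) * Real.exp (L * H (Y u' α x)) * L * (Real.sin α * Real.cos α) * K u u' * 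
        ∑ c, ε c * (G (Y u α x) c * G (Y u' α x) c)) := by
      refine Finset.sum_congr rfl fun u _ => ?_
      simp only [hf', Finset.mul_sum, Finset.sum_mul]
      rw [Finset.sum_comm]
      refine Finset.sum_congr rfl fun u' _ => Finset.sum_congr rfl fun c _ => ?_
      ring
    simp only [key, Pi.zero_apply]
    refine Finset.sum_nonpos fun u _ => Finset.sum_nonpos fun u' _ => ?_
    refine mul_nonpos_of_nonpos_of_nonneg (by linarith) ?_
    have := hGG (Y u α x) (Y u' α x)
    have := hK u u'
    have := (Real.rpow_pos_of_pos (hS0 α x) (p - 1 - 1)).le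
    positivity
  have hanti : AntitoneOn (fun α => ∫ x, S α x ^ p ∂μ) (Set.Icc 0 (Real.pi / 2)) := by
    refine antitoneOn_of_deriv_nonpos (convex_Icc _ _) (fun α _ => (hφ α).continuousAt.continuousWithinAt)
      (fun α _ => (hφ α).differentiableAt.differentiableWithinAt) fun α hα => ?_
    rw [interior_Icc] at hα
    rw [(hφ α).deriv]
    refine hneg α (mul_nonneg ?_ ?_)
    · exact (Real.sin_pos_of_pos_of_lt_pi hα.1 (by linarith [Real.pi_pos, hα.2])).le
    · exact (Real.cos_pos_of_mem_Ioo ⟨by linarith [Real.pi_pos, hα.1], hα.2⟩).le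
  have hpi := Real.pi_pos
  have := hanti (a := 0) (b := Real.pi / 2) ⟨le_rfl, by positivity⟩ ⟨by positivity, le_rfl⟩ (by positivity)
  simpa [hS, hY] using this

end gordon
end RG

open MeasureTheory ProbabilityTheory Matrix
namespace RG

/-- smoothed norm -/
noncomputable def NN {n : ℕ} (e : ℝ) (z : Fin n → ℝ) : ℝ := √(e + ∑ i, (z i) ^ 2)

lemma NN_pos {n : ℕ} {e : ℝ} (he : 0 < e) (z : Fin n → ℝ) : 0 < NN e z := by
  unfold NN; have : 0 ≤ ∑ i, (z i) ^ 2 := by positivity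
  positivity

lemma NN_sq {n : ℕ} {e : ℝ} (he : 0 < e) (z : Fin n → ℝ) : NN e z ^ 2 = e + ∑ i, (z i) ^ 2 := by
  unfold NN; have : 0 ≤ ∑ i, (z i) ^ 2 := by positivity
  exact Real.sq_sqrt (by positivity)

lemma continuous_NN {n : ℕ} (e : ℝ) : Continuous (NN (n := n) e) := by
  unfold NN; fun_prop

lemma NN_le {n : ℕ} {e : ℝ} (he : 0 < e) (z : Fin n → ℝ) : NN e z ≤ √e + ∑ i, |z i| := by
  unfold NN
  refine (Real.sqrt_le_sqrt ?_).trans_eq (Real.sqrt_sq (by positivity : 0 ≤ √e + ∑ i, |z i|))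
  have h1 : ∑ i, (z i) ^ 2 ≤ (∑ i, |z i|) ^ 2 := by
    have := Finset.sum_sq_le_sq_sum_of_nonneg (s := Finset.univ) (f := fun i => |z i|) (fun _ _ => abs_nonneg _)
    simpa using this
  have h2 := Real.sq_sqrt he.le
  have h3 : 0 ≤ √e * ∑ i, |z i| := by positivity
  nlinarith

lemma cs_le {n : ℕ} (x y : Fin n → ℝ) (a b : ℝ) (ha : 0 ≤ a) (hb : 0 ≤ b)
    (hx : ∑ i, x i ^ 2 ≤ a ^ 2) (hy : ∑ i, y i ^ 2 ≤ b ^ 2) : |∑ i, x i * y i| ≤ a * b := by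
  have h := Finset.sum_mul_sq_le_sq_mul_sq Finset.univ x y
  refine abs_le_of_sq_le_sq ?_ (by positivity)
  refine h.trans ?_
  rw [mul_pow]
  have : 0 ≤ ∑ i, y i ^ 2 := by positivity
  gcongr

/-- H function -/
noncomputable def HH {n : ℕ} (σ e : ℝ) (y : Option (Fin n) → ℝ) : ℝ := σ * (NN e (fun i => y (some i)) + y none)

/-- its gradient -/
noncomputable def HG {n : ℕ} (σ e : ℝ) (y : Option (Fin n) → ℝ) : Option (Fin n) → ℝ
  | none => σ
  | some i => σ * (y (some i) / NN e (fun i => y (some i)))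

lemma HH_deriv {n : ℕ} {σ e : ℝ} (he : 0 < e) (y : Option (Fin n) → ℝ) :
    HasFDerivAt (HH σ e) (∑ c, HG σ e y c • (ContinuousLinearMap.proj c : (Option (Fin n) → ℝ) →L[ℝ] ℝ)) y := by
  have h0 : 0 < e + ∑ i, (y (some i)) ^ 2 := by
    have : 0 ≤ ∑ i, (y (some i)) ^ 2 := by positivity
    positivity
  have h1 : HasFDerivAt (fun y : Option (Fin n) → ℝ => e + ∑ i, (y (some i)) ^ 2)
      (∑ i : Fin n, (2 * y (some i)) • (ContinuousLinearMap.proj (some i) : (Option (Fin n) → ℝ) →L[ℝ] ℝ)) y := by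
    refine HasFDerivAt.const_add e (HasFDerivAt.fun_sum fun i _ => ?_)
    have := ((ContinuousLinearMap.proj (some i) : (Option (Fin n) → ℝ) →L[ℝ] ℝ).hasFDerivAt (x := y)).pow 2
    convert! this using 1
    simp
  have h2 := h1.sqrt h0.ne'
  have h3 := (h2.add ((ContinuousLinearMap.proj none : (Option (Fin n) → ℝ) →L[ℝ] ℝ).hasFDerivAt (x := y))).const_mul σ
  convert! h3 using 1
  rw [Fintype.sum_option, add_comm]
  simp only [HG, Finset.smul_sum, smul_add, smul_smul]
  congr 1
  refine Finset.sum_congr rfl fun i _ => ?_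
  congr 1
  unfold NN
  have : 0 < √(e + ∑ i, (y (some i)) ^ 2) := by positivity
  field_simp

lemma HG_cont {n : ℕ} {σ e : ℝ} (he : 0 < e) : Continuous (HG (n := n) σ e) := by
  refine continuous_pi fun c => ?_
  rcases c with _ | i
  · exact continuous_const
  · simp only [HG]
    have : Continuous fun y : Option (Fin n) → ℝ => NN e (fun i => y (some i)) := (continuous_NN e).comp (by fun_prop)
    exact continuous_const.mul ((continuous_apply _).div this fun y => (NN_pos he _).ne')

lemma HG_le {n : ℕ} {σ e : ℝ} (hσ : |σ| = 1) (he : 0 < e) (y : Option (Fin n) → ℝ) (c) : |HG σ e y c| ≤ 1 := by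
  rcases c with _ | i
  · exact hσ.le
  · simp only [HG, abs_mul, hσ, one_mul, abs_div, abs_of_pos (NN_pos he _)]
    rw [div_le_one (NN_pos he _)]
    refine abs_le_of_sq_le_sq ?_ (NN_pos he _).le
    rw [NN_sq he]
    have := Finset.single_le_sum (f := fun i => (y (some i))^2) (fun _ _ => sq_nonneg _) (Finset.mem_univ i)
    linarith

lemma HH_le {n : ℕ} {σ e : ℝ} (hσ : |σ| = 1) (he : 0 < e) (y : Option (Fin n) → ℝ) :
    |HH σ e y| ≤ √e + ∑ c, |y c| := by
  unfold HH
  rw [abs_mul, hσ, one_mul, Fintype.sum_option]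
  have h1 := NN_le he (fun i => y (some i))
  refine (abs_add_le _ _).trans ?_
  rw [abs_of_pos (NN_pos he _)]
  linarith

lemma HG_pair {n : ℕ} {σ e : ℝ} (hσ : |σ| = 1) (he : 0 < e) (y y' : Option (Fin n) → ℝ) :
    0 ≤ ∑ c : Option (Fin n), (c.elim 1 (fun _ => -1) : ℝ) * (HG σ e y c * HG σ e y' c) := by
  have hs : σ * σ = 1 := by rw [← sq, ← sq_abs, hσ]; norm_num
  rw [Fintype.sum_option]
  simp only [HG, Option.elim, hs]
  set N := NN e (fun i => y (some i)) with hN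
  set N' := NN e (fun i => y' (some i)) with hN'
  have p1 : 0 < N := NN_pos he _
  have p2 : 0 < N' := NN_pos he _
  have h := cs_le (fun i => y (some i)) (fun i => y' (some i)) N N' p1.le p2.le (by rw [hN, NN_sq he]; linarith) (by rw [hN', NN_sq he]; linarith)
  have h' := (abs_le.1 h).2
  have e1 : ∑ i, (-1:ℝ) * (σ * (y (some i) / N) * (σ * (y' (some i) / N'))) = - ((∑ i, y (some i) * y' (some i)) / (N * N')) := by
    rw [Finset.sum_div, ← Finset.sum_neg_distrib]
    refine Finset.sum_congr rfl fun i _ => ?_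
    have : (-1:ℝ) * (σ * (y (some i) / N) * (σ * (y' (some i) / N'))) = - ((σ * σ) * (y (some i) * y' (some i) / (N * N'))) := by field_simp
    rw [this, hs, one_mul]
  rw [e1]
  have : (∑ i, y (some i) * y' (some i)) / (N * N') ≤ 1 := by
    rw [div_le_one (by positivity)]; exact h'
  linarith

/-- sample space -/
abbrev GS (n m : ℕ) := (Fin n → Fin m → ℝ) × (ℝ × ((Fin n → Fin 1 → ℝ) × (Fin m → Fin 1 → ℝ)))

/-- law -/
noncomputable abbrev GM (n m : ℕ) : Measure (GS n m) :=
  (gaussMatrix n m).prod ((gaussianReal 0 1).prod ((gaussMatrix n 1).prod (gaussMatrix m 1)))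

lemma GM_GD (n m : ℕ) : GD (GM n m) (fun x => (∑ i, ∑ j, (x.1 i j) ^ 2) + (x.2.1 ^ 2 + ((∑ i, ∑ j, (x.2.2.1 i j) ^ 2) + ∑ i, ∑ j, (x.2.2.2 i j) ^ 2))) := 
  (GD_mat n m).prod (GD_real.prod ((GD_mat n 1).prod (GD_mat m 1)))

lemma norm_le_l1 {n m : ℕ} (A : Fin n → Fin m → ℝ) : ‖A‖ ≤ l1 A := by
  rw [pi_norm_le_iff_of_nonneg (l1_nonneg A)]
  intro i
  rw [pi_norm_le_iff_of_nonneg (l1_nonneg A)]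
  intro j
  exact abs_le_l1 A i j

lemma GM_exp (n m : ℕ) (c : ℝ) : Integrable (fun x => Real.exp (c * ‖x‖)) (GM n m) := by
  have h := (integrable_exp_l1 n m |c|).mul_prod ((integrable_exp_abs |c|).mul_prod ((integrable_exp_l1 n 1 |c|).mul_prod (integrable_exp_l1 m 1 |c|)))
  refine h.mono' (by fun_prop) (Filter.Eventually.of_forall fun x => ?_)
  rw [Real.norm_eq_abs, Real.abs_exp, ← Real.exp_add, ← Real.exp_add, ← Real.exp_add, ← mul_add, ← mul_add, ← mul_add]
  apply Real.exp_le_exp.2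
  refine mul_le_mul (le_abs_self c) ?_ (norm_nonneg _) (abs_nonneg _)
  have h1 := norm_le_l1 x.1
  have h2 := norm_le_l1 x.2.2.1
  have h3 := norm_le_l1 x.2.2.2
  have h0 : 0 ≤ ‖x.2.1‖ := norm_nonneg _
  have p1 := l1_nonneg x.1
  have p2 := l1_nonneg x.2.2.1
  have p3 := l1_nonneg x.2.2.2
  have h4 : |x.2.1| = ‖x.2.1‖ := rfl
  rw [h4, Prod.norm_def, Prod.norm_def, Prod.norm_def]
  refine max_le (by linarith) (max_le (by linarith) (max_le (by linarith) (by linarith)))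

section
variable (n m : ℕ)
/-- coordinate -/
noncomputable def pA (i : Fin n) (j : Fin m) : GS n m →L[ℝ] ℝ :=
  ((ContinuousLinearMap.proj j : (Fin m → ℝ) →L[ℝ] ℝ) ∘L (ContinuousLinearMap.proj i : (Fin n → Fin m → ℝ) →L[ℝ] (Fin m → ℝ))) ∘L ContinuousLinearMap.fst ℝ _ _
/-- coordinate -/
noncomputable def pC : GS n m →L[ℝ] ℝ :=
  ContinuousLinearMap.fst ℝ _ _ ∘L ContinuousLinearMap.snd ℝ _ _
/-- coordinate -/
noncomputable def pg (i : Fin n) : GS n m →L[ℝ] ℝ :=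
  ((ContinuousLinearMap.proj (0 : Fin 1) : (Fin 1 → ℝ) →L[ℝ] ℝ) ∘L (ContinuousLinearMap.proj i : (Fin n → Fin 1 → ℝ) →L[ℝ] (Fin 1 → ℝ))) ∘L ContinuousLinearMap.fst ℝ _ _ ∘L
    ContinuousLinearMap.snd ℝ _ _ ∘L ContinuousLinearMap.snd ℝ _ _
/-- coordinate -/
noncomputable def ph (i : Fin m) : GS n m →L[ℝ] ℝ :=
  ((ContinuousLinearMap.proj (0 : Fin 1) : (Fin 1 → ℝ) →L[ℝ] ℝ) ∘L (ContinuousLinearMap.proj i : (Fin m → Fin 1 → ℝ) →L[ℝ] (Fin 1 → ℝ))) ∘L ContinuousLinearMap.snd ℝ _ _ ∘L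
    ContinuousLinearMap.snd ℝ _ _ ∘L ContinuousLinearMap.snd ℝ _ _

@[simp] lemma pA_apply (i j) (x : GS n m) : pA n m i j x = x.1 i j := rfl
@[simp] lemma pC_apply (x : GS n m) : pC n m x = x.2.1 := rfl
@[simp] lemma pg_apply (i) (x : GS n m) : pg n m i x = x.2.2.1 i 0 := rfl
@[simp] lemma ph_apply (i) (x : GS n m) : ph n m i x = x.2.2.2 i 0 := rfl

/-- derivative of quadratic form -/
noncomputable def qd (x : GS n m) : GS n m →L[ℝ] ℝ :=
  (∑ i, ∑ j, (2 * pA n m i j x) • pA n m i j) + ((2 * pC n m x) • pC n m + ((∑ i, (2 * pg n m i x) • pg n m i) + ∑ i, (2 * ph n m i x) • ph n m i))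

lemma clm_sq (l : GS n m →L[ℝ] ℝ) (x : GS n m) : HasFDerivAt (fun x => (l x) ^ 2) ((2 * l x) • l) x := by
  have := (l.hasFDerivAt (x := x)).pow 2
  convert! this using 1
  simp

lemma qd_deriv (x : GS n m) : HasFDerivAt (fun x : GS n m => (∑ i, ∑ j, (x.1 i j) ^ 2) + (x.2.1 ^ 2 + ((∑ i, ∑ j, (x.2.2.1 i j) ^ 2) + ∑ i, ∑ j, (x.2.2.2 i j) ^ 2))) (qd n m x) x := by
  simp only [Fin.sum_univ_one, Fin.isValue]
  exact (HasFDerivAt.fun_sum fun i _ => HasFDerivAt.fun_sum fun j _ => clm_sq n m (pA n m i j) x).add ((clm_sq n m (pC n m) x).add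
    ((HasFDerivAt.fun_sum fun i _ => clm_sq n m (pg n m i) x).add (HasFDerivAt.fun_sum fun i _ => clm_sq n m (ph n m i) x)))

end

instance mat_haar (n m : ℕ) : (volume : Measure (Fin n → Fin m → ℝ)).IsAddHaarMeasure :=
  Measure.pi.isAddHaarMeasure _

instance GS_haar (n m : ℕ) : (volume : Measure (GS n m)).IsAddHaarMeasure := by
  have h1 : (volume : Measure ((Fin n → Fin 1 → ℝ) × (Fin m → Fin 1 → ℝ))).IsAddHaarMeasure :=
    Measure.prod.instIsAddHaarMeasure _ _
  have h2 : (volume : Measure (ℝ × ((Fin n → Fin 1 → ℝ) × (Fin m → Fin 1 → ℝ)))).IsAddHaarMeasure :=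
    Measure.prod.instIsAddHaarMeasure _ _
  exact Measure.prod.instIsAddHaarMeasure _ _

lemma gordon_fin {ι : Type*} [Fintype ι] [Nonempty ι] (n m : ℕ) (U : ι → Fin m → ℝ) (hU : ∀ u, ∑ j, (U u j) ^ 2 = 1)
    (e σ L p : ℝ) (he : 0 < e) (hσ : |σ| = 1) (hL : 0 < L) (hp : 0 < p) (hp1 : p ≤ 1) :
    ∫ x : GS n m, (∑ u, Real.exp (L * (σ * (NN e (fun i => ∑ j, U u j * x.1 i j) + x.2.1)))) ^ p ∂(GM n m) ≤
    ∫ x : GS n m, (∑ u, Real.exp (L * (σ * (NN e (fun i => x.2.2.1 i 0) + ∑ j, U u j * x.2.2.2 j 0)))) ^ p ∂(GM n m) := by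
  have := gordon_abs (ι := ι) (κ := Option (Fin n)) (GM_GD n m) (GM_exp n m) (qd n m) (qd_deriv n m)
    (a := fun u c => c.elim (pC n m) (fun i => ∑ j, U u j • pA n m i j))
    (b := fun u c => c.elim (∑ j, U u j • ph n m j) (fun i => pg n m i))
    (da := fun u c => c.elim ((0, 1, 0, 0) : GS n m) (fun i => ((Pi.single i (U u), 0, 0, 0) : GS n m)))
    (db := fun u c => c.elim ((0, 0, 0, fun j _ => U u j) : GS n m) (fun i => ((0, 0, Pi.single i (fun _ => 1), 0) : GS n m)))
    ?_ ?_ ?_ ?_ (fun c => c.elim 1 (fun _ => -1)) (fun u u' => 1 - ∑ j, U u j * U u' j) ?_ ?_ ?_ ?_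
    (HH σ e) (HG σ e) (HH_deriv he) (HG_cont he) (HG_le hσ he) (√e) (HH_le hσ he) (HG_pair hσ he) L p hL hp hp1
  · simpa [SS, HH] using this
  · intro u c x
    rcases c with _ | i
    · simp [qd]
    · simp [qd, Pi.single_apply, Finset.mul_sum, apply_ite, ite_apply]
      exact Finset.sum_congr rfl fun j _ => by ring
  · intro u c x
    rcases c with _ | i
    · simp [qd, Finset.mul_sum]
      exact Finset.sum_congr rfl fun j _ => by ring
    · simp [qd, Pi.single_apply, ite_apply]
  · intro u c u' c'
    rcases c with _ | i <;> rcases c' with _ | i' <;> simp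
  · intro u c u' c'
    rcases c with _ | i <;> rcases c' with _ | i' <;> simp
  · intro u
    have := hU u
    simp only [sq] at this
    simp [this]
  · intro u u'
    have := cs_le (U u) (U u') 1 1 zero_le_one zero_le_one (by rw [hU]; norm_num) (by rw [hU]; norm_num)
    have := (abs_le.1 this).2
    linarith
  · intro u u' c
    rcases c with _ | i
    · simp [mul_comm]
    · simp [mul_comm]
  · intro u u' c c' hc
    rcases c with _ | i <;> rcases c' with _ | i'
    · exact absurd rfl hc
    · simp
    · simp
    · have : i' ≠ i := fun h => hc (by rw [h])
      simp [this]

end RG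

open MeasureTheory ProbabilityTheory Matrix
namespace RG

lemma sum_col_le {n m : ℕ} (A : Fin n → Fin m → ℝ) (v : Fin m → ℝ) (hv : ∀ j, |v j| ≤ 1) :
    ∑ i, |∑ j, v j * A i j| ≤ l1 A := by
  unfold l1
  refine Finset.sum_le_sum fun i _ => (Finset.abs_sum_le_sum_abs _ _).trans (Finset.sum_le_sum fun j _ => ?_)
  rw [abs_mul]; exact mul_le_of_le_one_left (abs_nonneg _) (hv j)

lemma unit_le {m : ℕ} (v : Fin m → ℝ) (hv : ∑ j, (v j) ^ 2 = 1) (j) : |v j| ≤ 1 := by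
  have := Finset.single_le_sum (f := fun i => (v i)^2) (fun _ _ => sq_nonneg _) (Finset.mem_univ j)
  refine abs_le_of_sq_le_sq ?_ zero_le_one
  rw [hv] at this; linarith

lemma integrable_exp_NN {n m : ℕ} {e : ℝ} (he : 0 < e) (c : ℝ) (v : Fin m → ℝ) (hv : ∑ j, (v j) ^ 2 = 1) :
    Integrable (fun A => Real.exp (c * NN e (fun i => ∑ j, v j * A i j))) (gaussMatrix n m) := by
  refine integrable_of_exp_bound _ ?_ (Real.exp (|c| * √e)) |c| fun A => ?_
  · refine Continuous.measurable (Real.continuous_exp.comp (continuous_const.mul ((continuous_NN e).comp ?_)))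
    fun_prop
  · rw [Real.abs_exp, ← Real.exp_add, ← mul_add]
    apply Real.exp_le_exp.2
    refine mul_le_mul (le_abs_self c) ((NN_le he _).trans ?_) (NN_pos he _).le (abs_nonneg _)
    have := sum_col_le A v (unit_le v hv)
    linarith

lemma integrable_exp_NN1 {n : ℕ} {e : ℝ} (he : 0 < e) (c : ℝ) :
    Integrable (fun A => Real.exp (c * NN e (fun i => A i 0))) (gaussMatrix n 1) := by
  have := integrable_exp_NN (n := n) (m := 1) he c (fun _ => 1) (by simp)
  simpa using this

lemma gordon_tail_L {ι : Type*} [Fintype ι] [Nonempty ι] (n m : ℕ) (U : ι → Fin m → ℝ) (hU : ∀ u, ∑ j, (U u j) ^ 2 = 1)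
    (e σ L l ρ : ℝ) (he : 0 < e) (hσ : |σ| = 1) (hl : 0 < l) (hL : l ≤ L) :
    Real.exp (l ^ 2 / 2) * (Real.exp (l * ρ) * (gaussMatrix n m).real {A | ∃ u, ρ ≤ σ * NN e (fun i => ∑ j, U u j * A i j)}) ≤
      (Fintype.card ι : ℝ) ^ (l / L) * ((∫ g, Real.exp (l * σ * NN e (fun i => g i 0)) ∂(gaussMatrix n 1)) *
        ∫ h, Real.exp (l * NN e (fun i => h i 0)) ∂(gaussMatrix m 1)) := by
  have hL0 : 0 < L := hl.trans_le hL
  set p := l / L with hp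
  have hp0 : 0 < p := by positivity
  have hp1 : p ≤ 1 := (div_le_one hL0).2 hL
  have hpL : p * L = l := by rw [hp]; field_simp
  have hLp : ∀ r, L * r * p = l * r := fun r => by rw [← hpL]; ring
  have hσ2 : σ ^ 2 = 1 := by rw [← sq_abs, hσ]; norm_num
  have main := gordon_fin n m U hU e σ L p he hσ hL0 hp0 hp1
  set F : (Fin n → Fin m → ℝ) → ℝ := fun A => (∑ u, Real.exp (L * (σ * NN e (fun i => ∑ j, U u j * A i j)))) ^ p with hF
  have hs0 : ∀ A : Fin n → Fin m → ℝ, 0 < ∑ u, Real.exp (L * (σ * NN e (fun i => ∑ j, U u j * A i j))) := fun A =>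
    Finset.sum_pos (fun _ _ => Real.exp_pos _) Finset.univ_nonempty
  have iF : Integrable F (gaussMatrix n m) := by
    have i1 : Integrable (fun A => 1 + ∑ u, Real.exp (L * σ * NN e (fun i => ∑ j, U u j * A i j))) (gaussMatrix n m) :=
      (integrable_const 1).add (integrable_finsetSum _ fun u _ => integrable_exp_NN he _ (U u) (hU u))
    refine i1.mono' ?_ (Filter.Eventually.of_forall fun A => ?_)
    · refine Continuous.aestronglyMeasurable (Continuous.rpow_const ?_ fun A => Or.inl (hs0 A).ne')
      refine continuous_finsetSum _ fun u _ => Real.continuous_exp.comp (continuous_const.mul (continuous_const.mul ((continuous_NN e).comp ?_)))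
      fun_prop
    · simp only [hF, mul_assoc]
      have h0 := hs0 A
      rw [Real.norm_eq_abs, abs_of_pos (Real.rpow_pos_of_pos h0 _)]
      refine (Real.rpow_le_rpow h0.le (le_add_of_nonneg_left zero_le_one) hp0.le).trans ?_
      refine (Real.rpow_le_rpow_of_exponent_le (by linarith) hp1).trans (by rw [Real.rpow_one])
  have hleft : ∫ x : GS n m, (∑ u, Real.exp (L * (σ * (NN e (fun i => ∑ j, U u j * x.1 i j) + x.2.1)))) ^ p ∂(GM n m)
      = (∫ A, F A ∂(gaussMatrix n m)) * Real.exp (l ^ 2 / 2) := by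
    have h1 : ∀ x : GS n m, (∑ u, Real.exp (L * (σ * (NN e (fun i => ∑ j, U u j * x.1 i j) + x.2.1)))) ^ p = 
        F x.1 * (fun y : ℝ × ((Fin n → Fin 1 → ℝ) × (Fin m → Fin 1 → ℝ)) => Real.exp ((l * σ) * y.1)) x.2 := by
      intro x
      have : ∑ u, Real.exp (L * (σ * (NN e (fun i => ∑ j, U u j * x.1 i j) + x.2.1))) = 
          (∑ u, Real.exp (L * (σ * NN e (fun i => ∑ j, U u j * x.1 i j)))) * Real.exp (L * (σ * x.2.1)) := by
        rw [Finset.sum_mul]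
        exact Finset.sum_congr rfl fun u _ => by rw [← Real.exp_add]; congr 1; ring
      rw [this, Real.mul_rpow (hs0 x.1).le (Real.exp_pos _).le, ← Real.exp_mul, hLp]
      simp only [hF, mul_assoc]
    simp only [h1]
    rw [integral_prod_mul F (fun y : ℝ × ((Fin n → Fin 1 → ℝ) × (Fin m → Fin 1 → ℝ)) => Real.exp ((l * σ) * y.1)), integral_fun_fst (fun y : ℝ => Real.exp ((l * σ) * y))]
    have h2 := congrFun (mgf_id_gaussianReal (μ := 0) (v := 1)) (l * σ)
    simp only [mgf, id] at h2
    rw [h2]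
    simp [mul_pow, hσ2]
  have hright : ∫ x : GS n m, (∑ u, Real.exp (L * (σ * (NN e (fun i => x.2.2.1 i 0) + ∑ j, U u j * x.2.2.2 j 0)))) ^ p ∂(GM n m)
      ≤ (Fintype.card ι : ℝ) ^ p * ((∫ g, Real.exp (l * σ * NN e (fun i => g i 0)) ∂(gaussMatrix n 1)) *
        ∫ h, Real.exp (l * NN e (fun i => h i 0)) ∂(gaussMatrix m 1)) := by
    have ig := integrable_exp_NN1 (n := n) he (l * σ)
    have ih := integrable_exp_NN1 (n := m) he l
    have igh := (ig.mul_prod ih)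
    have i3 := (igh.comp_snd (μ := gaussianReal 0 1)).comp_snd (μ := gaussMatrix n m)
    have e1 : ∫ x : GS n m, (Fintype.card ι : ℝ) ^ p * (Real.exp (l * σ * NN e (fun i => x.2.2.1 i 0)) * Real.exp (l * NN e (fun i => x.2.2.2 i 0))) ∂(GM n m) = 
       (Fintype.card ι : ℝ) ^ p * ((∫ g, Real.exp (l * σ * NN e (fun i => g i 0)) ∂(gaussMatrix n 1)) *
        ∫ h, Real.exp (l * NN e (fun i => h i 0)) ∂(gaussMatrix m 1)) := by
      rw [integral_const_mul]
      congr 1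
      rw [integral_fun_snd (fun y : ℝ × ((Fin n → Fin 1 → ℝ) × (Fin m → Fin 1 → ℝ)) => Real.exp (l * σ * NN e (fun i => y.2.1 i 0)) * Real.exp (l * NN e (fun i => y.2.2 i 0))),
        integral_fun_snd (fun y : ((Fin n → Fin 1 → ℝ) × (Fin m → Fin 1 → ℝ)) => Real.exp (l * σ * NN e (fun i => y.1 i 0)) * Real.exp (l * NN e (fun i => y.2 i 0))),
        integral_prod_mul (fun g : Fin n → Fin 1 → ℝ => Real.exp (l * σ * NN e (fun i => g i 0))) (fun h : Fin m → Fin 1 → ℝ => Real.exp (l * NN e (fun i => h i 0)))]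
      simp
    rw [← e1]
    refine integral_mono_of_nonneg (Filter.Eventually.of_forall fun x => ?_) (i3.const_mul _) (Filter.Eventually.of_forall fun x => ?_)
    · simp only [Pi.zero_apply]; positivity
    · simp only
      have h1 : ∑ u, Real.exp (L * (σ * (NN e (fun i => x.2.2.1 i 0) + ∑ j, U u j * x.2.2.2 j 0))) ≤
          (Fintype.card ι : ℝ) * Real.exp (L * (σ * NN e (fun i => x.2.2.1 i 0) + NN e (fun i => x.2.2.2 i 0))) := by
        refine (Finset.sum_le_card_nsmul _ _ _ fun u _ => ?_).trans_eq (by rw [Finset.card_univ, nsmul_eq_mul])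
        apply Real.exp_le_exp.2
        refine mul_le_mul_of_nonneg_left ?_ hL0.le
        rw [mul_add]
        refine add_le_add le_rfl ?_
        refine (le_abs_self _).trans ?_
        rw [abs_mul, hσ, one_mul]
        refine (cs_le (U u) (fun j => x.2.2.2 j 0) 1 (NN e (fun i => x.2.2.2 i 0)) zero_le_one (NN_pos he _).le (by rw [hU]; norm_num) ?_).trans_eq (one_mul _)
        rw [NN_sq he]; linarith
      refine (Real.rpow_le_rpow (by positivity) h1 hp0.le).trans_eq ?_
      rw [Real.mul_rpow (by positivity) (Real.exp_pos _).le, ← Real.exp_mul, hLp, ← Real.exp_add]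
      congr 2; ring
  rw [hleft] at main
  have fin := main.trans hright
  refine le_trans ?_ fin
  rw [mul_comm]
  refine mul_le_mul_of_nonneg_right ?_ (Real.exp_pos _).le
  refine le_trans ?_ (mul_meas_ge_le_integral_of_nonneg (Filter.Eventually.of_forall fun A => (Real.rpow_pos_of_pos (hs0 A) p).le) iF (Real.exp (l * ρ)))
  refine mul_le_mul_of_nonneg_left (measureReal_mono ?_) (Real.exp_pos _).le
  rintro A ⟨u, hu⟩
  change Real.exp (l * ρ) ≤ F A
  have h1 : Real.exp (L * ρ) ≤ ∑ u, Real.exp (L * (σ * NN e (fun i => ∑ j, U u j * A i j))) := by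
    refine le_trans ?_ (Finset.single_le_sum (f := fun u => Real.exp (L * (σ * NN e (fun i => ∑ j, U u j * A i j)))) (fun _ _ => (Real.exp_pos _).le) (Finset.mem_univ u))
    apply Real.exp_le_exp.2
    exact mul_le_mul_of_nonneg_left hu hL0.le
  refine le_trans (le_of_eq ?_) (Real.rpow_le_rpow (Real.exp_pos _).le h1 hp0.le)
  rw [← Real.exp_mul, hLp]

lemma gordon_tail {ι : Type*} [Fintype ι] (n m : ℕ) (U : ι → Fin m → ℝ) (hU : ∀ u, ∑ j, (U u j) ^ 2 = 1)
    (e σ l ρ : ℝ) (he : 0 < e) (hσ : |σ| = 1) (hl : 0 < l) :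
    (gaussMatrix n m).real {A | ∃ u, ρ ≤ σ * NN e (fun i => ∑ j, U u j * A i j)} ≤
      Real.exp (-(l * ρ) - l ^ 2 / 2) * ((∫ g, Real.exp (l * σ * NN e (fun i => g i 0)) ∂(gaussMatrix n 1)) *
        ∫ h, Real.exp (l * NN e (fun i => h i 0)) ∂(gaussMatrix m 1)) := by
  rcases isEmpty_or_nonempty ι with hι | hι
  · simp only [IsEmpty.exists_iff, Set.setOf_false, measureReal_empty]
    exact mul_nonneg (Real.exp_pos _).le (mul_nonneg (integral_nonneg fun _ => (Real.exp_pos _).le) (integral_nonneg fun _ => (Real.exp_pos _).le))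
  set J := ((∫ g, Real.exp (l * σ * NN e (fun i => g i 0)) ∂(gaussMatrix n 1)) *
        ∫ h, Real.exp (l * NN e (fun i => h i 0)) ∂(gaussMatrix m 1)) with hJ
  set P := (gaussMatrix n m).real {A | ∃ u, ρ ≤ σ * NN e (fun i => ∑ j, U u j * A i j)} with hP
  have h1 : ∀ᶠ L in Filter.atTop, Real.exp (l ^ 2 / 2) * (Real.exp (l * ρ) * P) ≤ (Fintype.card ι : ℝ) ^ (l / L) * J := by
    filter_upwards [Filter.eventually_ge_atTop l] with L hL
    exact gordon_tail_L n m U hU e σ L l ρ he hσ hl hL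
  have hc : (0:ℝ) < (Fintype.card ι : ℝ) := by exact_mod_cast Fintype.card_pos
  have h2 : Filter.Tendsto (fun L : ℝ => (Fintype.card ι : ℝ) ^ (l / L) * J) Filter.atTop (nhds ((Fintype.card ι : ℝ) ^ (0:ℝ) * J)) := by
    refine Filter.Tendsto.mul_const _ ?_
    refine Filter.Tendsto.rpow tendsto_const_nhds ?_ (Or.inl hc.ne')
    exact tendsto_const_nhds.div_atTop Filter.tendsto_id
  have h3 := ge_of_tendsto h2 h1
  rw [Real.rpow_zero, one_mul] at h3
  have h4 : P = Real.exp (-(l * ρ) - l ^ 2 / 2) * (Real.exp (l ^ 2 / 2) * (Real.exp (l * ρ) * P)) := by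
    rw [← mul_assoc, ← mul_assoc, ← Real.exp_add, ← Real.exp_add]
    have : -(l * ρ) - l ^ 2 / 2 + l ^ 2 / 2 + l * ρ = 0 := by ring
    rw [this, Real.exp_zero, one_mul]
  rw [h4]
  exact mul_le_mul_of_nonneg_left h3 (Real.exp_pos _).le

end RG

open MeasureTheory ProbabilityTheory Matrix
namespace RG

lemma union_bound {X : Type*} [MeasurableSpace X] (μ : Measure X) [IsProbabilityMeasure μ] (E : ℕ → Set X) (hm : Monotone E)
    (b : ℝ) (h : ∀ k, μ.real (E k) ≤ b) : μ.real (⋃ k, E k) ≤ b := by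
  have h1 := tendsto_measure_iUnion_atTop (μ := μ) hm
  have h2 := (ENNReal.tendsto_toReal (measure_ne_top μ (⋃ k, E k))).comp h1
  exact le_of_tendsto h2 (Filter.Eventually.of_forall h)

lemma le_of_exp_mul {x b : ℝ} (h : ∀ d, 0 < d → x ≤ Real.exp d * b) : x ≤ b := by
  have h2 : Filter.Tendsto (fun d : ℝ => Real.exp d * b) (nhdsWithin 0 (Set.Ioi 0)) (nhds (Real.exp 0 * b)) :=
    ((Real.continuous_exp.tendsto 0).mul_const b).mono_left nhdsWithin_le_nhds
  rw [Real.exp_zero, one_mul] at h2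
  refine ge_of_tendsto h2 ?_
  filter_upwards [self_mem_nhdsWithin] with d hd using h d hd

/-- unit sphere -/
abbrev Sph (m : ℕ) := {v : Fin m → ℝ // ∑ j, (v j) ^ 2 = 1}

lemma sph_ne (m : ℕ) (hm : 1 ≤ m) : Nonempty (Sph m) := by
  refine ⟨⟨Pi.single ⟨0, hm⟩ 1, ?_⟩⟩
  rw [Finset.sum_eq_single (⟨0, hm⟩ : Fin m)]
  · simp
  · intro j _ hj; simp [hj]
  · simp

lemma sph_dense (m : ℕ) (hm : 1 ≤ m) : ∃ d : ℕ → Sph m, DenseRange d := by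
  have := sph_ne m hm
  exact TopologicalSpace.exists_dense_seq (Sph m)

/-- Euclidean norm of the image -/
noncomputable def AN {n m : ℕ} (A : Fin n → Fin m → ℝ) (v : Fin m → ℝ) : ℝ := √(∑ i, (∑ j, v j * A i j) ^ 2)

lemma AN_cont {n m : ℕ} (A : Fin n → Fin m → ℝ) : Continuous (fun v : Sph m => AN A v.1) := by
  unfold AN
  have : ∀ j, Continuous (fun v : Sph m => v.1 j) := fun j => (continuous_apply j).comp continuous_subtype_val
  refine Real.continuous_sqrt.comp (continuous_finsetSum _ fun i _ => (continuous_finsetSum _ fun j _ => (this j).mul continuous_const).pow 2)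

lemma upper_tail (n m : ℕ) (hn : 1 ≤ n) (hm : 1 ≤ m) (T : ℝ) (hT : 0 < T) :
    (gaussMatrix n m).real {A | ∃ v : Sph m, √n + √m + T < AN A v.1} ≤ Real.exp (-T ^ 2 / 2) := by
  obtain ⟨d, hd⟩ := sph_dense m hm
  refine le_of_exp_mul fun e he => ?_
  set E : ℕ → Set (Fin n → Fin m → ℝ) := fun N => {A | ∃ k : Fin N, √n + √m + T ≤ 1 * NN e (fun i => ∑ j, (d k).1 j * A i j)} with hE
  have hmono : Monotone E := by
    intro N N' hN A hA
    obtain ⟨k, hk⟩ := hA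
    exact ⟨Fin.castLE hN k, hk⟩
  refine (measureReal_mono ?_).trans (union_bound (gaussMatrix n m) E hmono _ fun N => ?_)
  · rintro A ⟨v, hv⟩
    have ho : IsOpen {v : Sph m | √n + √m + T < AN A v.1} := isOpen_lt continuous_const (AN_cont A)
    obtain ⟨k, hk⟩ := hd.exists_mem_open ho ⟨v, hv⟩
    refine Set.mem_iUnion.2 ⟨k + 1, ⟨⟨k, by omega⟩, ?_⟩⟩
    rw [one_mul]
    refine (le_of_lt hk).trans ?_
    unfold AN NN
    apply Real.sqrt_le_sqrt; linarith
  · refine (gordon_tail n m (fun k : Fin N => (d k).1) (fun k => (d k).2) e 1 T (√n + √m + T) he (by simp) hT).trans ?_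
    have h1 := (mgf_up n hn T e hT he).2
    have h2 := (mgf_up m hm T e hT he).2
    have h3 := mul_le_mul h1 h2 (integral_nonneg fun _ => (Real.exp_pos _).le) (by positivity)
    simp only [mul_one]
    refine (mul_le_mul_of_nonneg_left h3 (Real.exp_pos _).le).trans_eq ?_
    simp only [← Real.exp_add]
    congr 1
    ring

lemma low_mgf (n : ℕ) (hn : 1 ≤ n) (l e : ℝ) (hl : 0 < l) (he : 0 < e) (h2 : 2 ≤ l * √n) (h3 : 3 * l ≤ √n) :
    ∫ g, Real.exp (l * (-1) * NN e (fun i => g i 0)) ∂(gaussMatrix n 1) ≤ Real.exp (- (l * √n) + 3 / 4 * l ^ 2) := by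
  have hn0 : (0:ℝ) < n := by positivity
  have hs : 0 < √(n:ℝ) := by positivity
  have hsq : √(n:ℝ) ^ 2 = n := Real.sq_sqrt hn0.le
  set k := l * √n / 2 with hk
  have hk1 : 1 ≤ k := by rw [hk]; linarith
  have hpos : 0 < (n:ℝ) - l * √n := by nlinarith
  have hdm := det_moment (n := n) (m := 1) e k he hk1 1 le_rfl (by push_cast; rw [hk]; linarith)
  have hdet : ∀ g : Fin n → Fin 1 → ℝ, (W (cols 1 le_rfl g) e).det = e + ∑ i, (g i 0) ^ 2 := by
    intro g
    rw [Matrix.det_fin_one]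
    simp [W, cols, mul_apply, sq]
  simp only [hdet] at hdm
  rw [Finset.prod_range_one] at hdm
  have hp : ∀ g : Fin n → Fin 1 → ℝ, e ≤ e + ∑ i, (g i 0) ^ 2 := fun g => by
    have : 0 ≤ ∑ i, (g i 0) ^ 2 := by positivity
    linarith
  have hint : Integrable (fun g : Fin n → Fin 1 → ℝ => (e + ∑ i, (g i 0) ^ 2) ^ (-k)) (gaussMatrix n 1) := by
    refine integrable_of_exp_bound _ ?_ (e ^ (-k)) 0 fun g => ?_
    · refine Continuous.measurable (Continuous.rpow_const (by fun_prop) fun g => Or.inl (by have := hp g; linarith))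
    · rw [abs_of_pos (Real.rpow_pos_of_pos (he.trans_le (hp g)) _)]
      simpa using Real.rpow_le_rpow_of_nonpos he (hp g) (by linarith)
  have hpt : ∀ g : Fin n → Fin 1 → ℝ, Real.exp (l * (-1) * NN e (fun i => g i 0)) ≤ (Real.exp (-(l * √n)) * (n:ℝ) ^ k) * (e + ∑ i, (g i 0) ^ 2) ^ (-k) := by
    intro g
    set X := e + ∑ i, (g i 0) ^ 2 with hX
    have hX0 : 0 < X := he.trans_le (hp g)
    have hNN : NN e (fun i => g i 0) = √X := rfl
    have hrX : 0 < √X := by positivity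
    rw [hNN, Real.rpow_def_of_pos hX0, Real.rpow_def_of_pos hn0, ← Real.exp_add, ← Real.exp_add]
    apply Real.exp_le_exp.2
    have hlog := Real.log_le_sub_one_of_pos (div_pos hrX hs)
    rw [Real.log_div hrX.ne' hs.ne', Real.log_sqrt hX0.le, Real.log_sqrt hn0.le] at hlog
    have := mul_le_mul_of_nonneg_left hlog (by positivity : 0 ≤ l * √n)
    have e1 : l * √n * (√X / √n - 1) = l * √X - l * √n := by field_simp
    rw [e1] at this
    rw [hk]
    linarith
  refine (integral_mono (by simpa [mul_assoc] using integrable_exp_NN1 (n := n) he (l * (-1))) (hint.const_mul _) hpt).trans ?_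
  rw [integral_const_mul]
  refine (mul_le_mul_of_nonneg_left hdm (by positivity)).trans ?_
  have e2 : (n:ℝ) - ((0:ℕ):ℝ) - 2 * k = n - l * √n := by rw [hk]; push_cast; ring
  rw [e2, Real.rpow_def_of_pos hpos, Real.rpow_def_of_pos hn0, ← Real.exp_add, ← Real.exp_add]
  apply Real.exp_le_exp.2
  have hlog := Real.log_le_sub_one_of_pos (div_pos hn0 hpos)
  rw [Real.log_div hn0.ne' hpos.ne'] at hlog
  have e3 : (n:ℝ) / (n - l * √n) - 1 ≤ 3 / 2 * l / √n := by
    rw [div_sub_one hpos.ne', div_le_div_iff₀ hpos hs]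
    have : l * √n * (3 * l) ≤ l * √n * √n := by gcongr
    nlinarith
  have e4 := mul_le_mul_of_nonneg_left (hlog.trans e3) (by positivity : 0 ≤ l * √n / 2)
  have e5 : l * √n / 2 * (3 / 2 * l / √n) = 3 / 4 * l ^ 2 := by field_simp; ring
  rw [e5] at e4
  rw [hk]
  linarith

lemma lower_tail (n m : ℕ) (hn : 1 ≤ n) (hm : 1 ≤ m) (l r : ℝ) (hl : 0 < l) (h2 : 2 ≤ l * √n) (h3 : 3 * l ≤ √n) :
    (gaussMatrix n m).real {A | ∃ v : Sph m, AN A v.1 < r} ≤ Real.exp (l * (r - √n + √m) + 3 / 4 * l ^ 2) := by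
  obtain ⟨d, hd⟩ := sph_dense m hm
  refine le_of_exp_mul fun δ hδ => ?_
  set E : ℕ → Set (Fin n → Fin m → ℝ) := fun N => {A | ∃ k : Fin N, -r ≤ (-1) * NN (δ / (N + 1)) (fun i => ∑ j, (d k).1 j * A i j)} with hE
  have hmono : Monotone E := by
    intro N N' hN A hA
    obtain ⟨k, hk⟩ := hA
    refine ⟨Fin.castLE hN k, hk.trans ?_⟩
    have : NN (δ / (N' + 1)) (fun i => ∑ j, (d k).1 j * A i j) ≤ NN (δ / (N + 1)) (fun i => ∑ j, (d k).1 j * A i j) := by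
      unfold NN
      have hN2 : (N:ℝ) ≤ N' := by exact_mod_cast hN
      gcongr
    simp only [Fin.val_castLE]
    linarith
  refine (measureReal_mono ?_).trans (union_bound (gaussMatrix n m) E hmono _ fun N => ?_)
  · rintro A ⟨v, hv⟩
    have ho : IsOpen {v : Sph m | AN A v.1 < r} := isOpen_lt (AN_cont A) continuous_const
    obtain ⟨k, hk⟩ := hd.exists_mem_open ho ⟨v, hv⟩
    have ht : Filter.Tendsto (fun N : ℕ => NN (δ / ((N:ℝ) + 1)) (fun i => ∑ j, (d k).1 j * A i j)) Filter.atTop (nhds (AN A (d k).1)) := by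
      unfold NN AN
      have h0 : Filter.Tendsto (fun N : ℕ => δ / ((N:ℝ) + 1)) Filter.atTop (nhds 0) := 
        tendsto_const_nhds.div_atTop (Filter.tendsto_atTop_add_const_right _ _ tendsto_natCast_atTop_atTop)
      have := (h0.add_const (∑ i, (∑ j, (d k).1 j * A i j) ^ 2)).sqrt
      simpa using this
    have hev := (ht.eventually_lt_const hk).and (Filter.eventually_gt_atTop k)
    obtain ⟨N, hN1, hN2⟩ := hev.exists
    refine Set.mem_iUnion.2 ⟨N, ⟨⟨k, hN2⟩, ?_⟩⟩
    simp only
    linarith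
  · have hN : (0:ℝ) < N + 1 := by positivity
    have he : 0 < δ / ((N:ℝ) + 1) := by positivity
    have heδ : δ / ((N:ℝ) + 1) ≤ δ := div_le_self hδ.le (by have : (0:ℝ) ≤ N := by positivity
                                                            linarith)
    refine (gordon_tail n m (fun k : Fin N => (d k).1) (fun k => (d k).2) (δ / ((N:ℝ) + 1)) (-1) l (-r) he (by simp) hl).trans ?_
    have h1 := low_mgf n hn l _ hl he h2 h3
    have h2 := (mgf_up m hm l _ hl he).2
    have h3 := mul_le_mul h1 h2 (integral_nonneg fun _ => (Real.exp_pos _).le) (by positivity)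
    refine (mul_le_mul_of_nonneg_left h3 (Real.exp_pos _).le).trans ?_
    simp only [← Real.exp_add]
    apply Real.exp_le_exp.2
    nlinarith

end RG

open MeasureTheory ProbabilityTheory Matrix
namespace RG

lemma det_markov (n m : ℕ) (k δ : ℝ) (hk : 1 ≤ k) (hδ : 0 < δ) (hpos : 0 < (n : ℝ) - (m - 1) - 2 * k) :
    (gaussMatrix n m).real {A | ((Matrix.of A)ᵀ * Matrix.of A).det < δ} ≤
      δ ^ k * ∏ i ∈ Finset.range m, ((n : ℝ) - i - 2 * k) ^ (-k) := by
  set e : ℕ → ℝ := fun N => 1 / ((N:ℝ) + 1) with he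
  have he0 : ∀ N, 0 < e N := fun N => by simp only [he]; positivity
  set E : ℕ → Set (Fin n → Fin m → ℝ) := fun N => {A | (W (cols m le_rfl A) (e N)).det < δ} with hE
  set F : ℕ → Set (Fin n → Fin m → ℝ) := fun N => {A | ∀ M, N ≤ M → A ∈ E M} with hF
  have hmono : Monotone F := fun N N' hN A hA M hM => hA M (hN.trans hM)
  refine (measureReal_mono ?_).trans (union_bound (gaussMatrix n m) F hmono _ fun N => ?_)
  · intro A hA
    have hc : cols m le_rfl A = Matrix.of A := by ext i j; simp [cols]
    have h1 : Continuous (fun x : ℝ => (W (Matrix.of A) x).det) := by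
      unfold W
      refine Continuous.matrix_det ?_
      fun_prop
    have h2 : Filter.Tendsto e Filter.atTop (nhds 0) := tendsto_one_div_add_atTop_nhds_zero_nat
    have h3 := (h1.tendsto 0).comp h2
    have h4 : (W (Matrix.of A) 0).det < δ := by
      simp only [W, zero_smul, zero_add]; exact hA
    obtain ⟨N, hN⟩ := Filter.eventually_atTop.1 (h3.eventually_lt_const h4)
    refine Set.mem_iUnion.2 ⟨N, fun M hM => ?_⟩
    have := hN M hM
    change (W (cols m le_rfl A) (e M)).det < δ
    rw [hc]; exact this
  · have h1 : F N ⊆ {A | δ ^ (-k) ≤ (W (cols m le_rfl A) (e N)).det ^ (-k)} := by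
      intro A hA
      have := hA N le_rfl
      exact Real.rpow_le_rpow_of_nonpos (W_det_pos _ (he0 N)) (le_of_lt this) (by linarith)
    have hint : Integrable (fun A : Fin n → Fin m → ℝ => (W (cols m le_rfl A) (e N)).det ^ (-k)) (gaussMatrix n m) := by
      refine integrable_of_exp_bound _ ?_ ((e N ^ m) ^ (-k)) 0 fun A => ?_
      · exact Continuous.measurable ((continuous_W m le_rfl (e N)).matrix_det.rpow_const fun A => Or.inl (W_det_pos _ (he0 N)).ne')
      · rw [abs_of_pos (Real.rpow_pos_of_pos (W_det_pos _ (he0 N)) _)]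
        simpa using Real.rpow_le_rpow_of_nonpos (pow_pos (he0 N) m) (W_det_lower (he0 N) m _) (by linarith)
    have h2 := mul_meas_ge_le_integral_of_nonneg (Filter.Eventually.of_forall fun A => (Real.rpow_pos_of_pos (W_det_pos (cols m le_rfl A) (he0 N)) (-k)).le) hint (δ ^ (-k))
    have h3 := det_moment (n := n) (m := m) (e N) k (he0 N) hk m le_rfl hpos
    have h4 : δ ^ (-k) * (gaussMatrix n m).real (F N) ≤ ∏ i ∈ Finset.range m, ((n : ℝ) - i - 2 * k) ^ (-k) :=
      ((mul_le_mul_of_nonneg_left (measureReal_mono h1) (by positivity)).trans h2).trans h3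
    have h5 : (gaussMatrix n m).real (F N) = δ ^ k * (δ ^ (-k) * (gaussMatrix n m).real (F N)) := by
      rw [← mul_assoc, ← Real.rpow_add hδ]; simp
    rw [h5]
    exact mul_le_mul_of_nonneg_left h4 (by positivity)

lemma prod_fact (m : ℕ) : ∏ i ∈ Finset.range m, ((m:ℝ) - i) = m.factorial := by
  rw [← Finset.prod_range_add_one_eq_factorial, ← Finset.prod_range_reflect]
  push_cast
  refine Finset.prod_congr rfl fun i hi => ?_
  have := Finset.mem_range.1 hi
  rw [Nat.cast_sub (by omega), Nat.cast_sub (by omega)]; push_cast; ring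

lemma sum_log1 (m : ℕ) (hm : 1 ≤ m) : -(m:ℝ) ≤ ∑ i ∈ Finset.range m, Real.log (1 - i / m) := by
  have hm0 : (0:ℝ) < m := by positivity
  have hlt : ∀ i ∈ Finset.range m, (0:ℝ) < 1 - i / m := fun i hi => by
    have := Finset.mem_range.1 hi
    have h : (i:ℝ) < m := by exact_mod_cast this
    rw [sub_pos, div_lt_one hm0]; exact h
  rw [← Real.log_prod (fun i hi => (hlt i hi).ne')]
  have h1 : ∏ i ∈ Finset.range m, (1 - (i:ℝ) / m) = m.factorial / (m:ℝ) ^ m := by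
    rw [← prod_fact, eq_div_iff (by positivity)]
    conv_lhs => rw [← Finset.card_range m, ← Finset.prod_const]
    rw [Finset.card_range, ← Finset.prod_mul_distrib]
    exact Finset.prod_congr rfl fun i _ => by field_simp
  rw [h1, Real.le_log_iff_exp_le (by positivity), Real.exp_neg]
  have h2 := Real.pow_div_factorial_le_exp (m:ℝ) hm0.le m
  rw [← inv_div]
  exact inv_anti₀ (by positivity) h2

lemma sum_log2 (m : ℕ) (hm : 1 ≤ m) (z : ℝ) (hz0 : 0 ≤ z) (hz1 : z ≤ 1) :
    -(z * m) ≤ ∑ i ∈ Finset.range m, Real.log (1 - z * (i / m)) := by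
  have hm0 : (0:ℝ) < m := by positivity
  have h := mul_le_mul_of_nonneg_left (sum_log1 m hm) hz0
  rw [Finset.mul_sum] at h
  refine le_trans (by linarith) (h.trans (Finset.sum_le_sum fun i hi => ?_))
  have h1 : (i:ℝ) < m := by exact_mod_cast Finset.mem_range.1 hi
  have h2 : (0:ℝ) < 1 - i / m := by rw [sub_pos, div_lt_one hm0]; exact h1
  rw [← Real.log_rpow h2]
  refine Real.log_le_log (by positivity) ?_
  have := rpow_one_add_le_one_add_mul_self (s := -((i:ℝ)/m)) (by linarith) hz0 hz1
  rw [← sub_eq_add_neg] at this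
  linarith

lemma k_ge (n : ℕ) (t : ℝ) (ht : 1.1773 ≤ t) (hn : 5 ≤ n) : 2 ≤ (n:ℝ) * (1 - Real.exp (-(t / √n))) := by
  have hn0 : (5:ℝ) ≤ n := by exact_mod_cast hn
  have hx : 0 < √(n:ℝ) := by positivity
  have hsq : √(n:ℝ) ^ 2 = n := Real.sq_sqrt (by linarith)
  set x := √(n:ℝ) with hxd
  set τ := t / x with hτ
  have hτx : τ * x = t := by rw [hτ]; field_simp
  have hτ0 : 0 < τ := by rw [hτ]; exact div_pos (by linarith) hx
  have key : (n:ℝ) ≤ (n - 2) * Real.exp τ := by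
    rcases Nat.lt_or_ge n 6 with h | h
    · have hn5 : n = 5 := by omega
      subst hn5
      have hx2 : x ≤ 2.2361 := by
        rw [hxd]; rw [Real.sqrt_le_left (by norm_num)]; norm_num
      have hτ1 : 0.5264 ≤ τ := by rw [hτ, le_div_iff₀ hx]; linarith
      have := Real.sum_le_exp_of_nonneg hτ0.le 4
      simp [Finset.sum_range_succ, Nat.factorial] at this
      have h3 : 0.5264 ^ 3 ≤ τ ^ 3 := by gcongr
      have h2 : 0.5264 ^ 2 ≤ τ ^ 2 := by gcongr
      norm_num at h3 h2 ⊢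
      linarith
    · have hn6 : (6:ℝ) ≤ n := by exact_mod_cast h
      have h1 := Real.quadratic_le_exp_of_nonneg hτ0.le
      have hx2 : 2.4 ≤ x := by rw [hxd]; apply Real.le_sqrt_of_sq_le; linarith
      have h2 : (n - 2) * (1 + τ + τ ^ 2 / 2) ≤ (n - 2) * Real.exp τ := by
        apply mul_le_mul_of_nonneg_left h1; linarith
      refine le_trans ?_ h2
      have h3 : 2 / 3 * (n:ℝ) * (τ + τ ^ 2 / 2) ≤ (n - 2) * (τ + τ ^ 2 / 2) := by
        apply mul_le_mul_of_nonneg_right _ (by positivity); linarith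
      have h4 : (n:ℝ) * (τ + τ ^ 2 / 2) = x * t + t ^ 2 / 2 := by rw [← hsq, ← hτx]; ring
      have h5 : 2.4 * 1.1773 ≤ x * t := by gcongr
      have h6 : 1.1773 ^ 2 ≤ t ^ 2 := by gcongr
      nlinarith
  rw [Real.exp_neg]
  have he := Real.exp_pos τ
  have : (n:ℝ) * (1 - (Real.exp τ)⁻¹) - 2 = ((n - 2) * Real.exp τ - n) / Real.exp τ := by field_simp; ring
  have h2 : 0 ≤ ((n - 2) * Real.exp τ - n) / Real.exp τ := div_nonneg (by linarith) he.le
  linarith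

set_option maxHeartbeats 1600000 in
lemma det_tail (n m : ℕ) (hm : 1 ≤ m) (hn : 5 ≤ n) (t : ℝ) (ht : 1.1773 ≤ t) (h : √m + t < √n) :
    (gaussMatrix n m).real {A | ((Matrix.of A)ᵀ * Matrix.of A).det <
      (n:ℝ) ^ m * Real.exp (-((m : ℝ) * ((√m + t) ^ 2 / n + 2 * (√m + t) / √n)))} ≤ Real.exp (-t ^ 2 / 2) := by
  have hn0 : (0:ℝ) < n := by positivity
  have hm0 : (0:ℝ) < m := by positivity
  have hm1 : (1:ℝ) ≤ m := by exact_mod_cast hm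
  have hx : 0 < √(n:ℝ) := by positivity
  have hy : 0 < √(m:ℝ) := by positivity
  have hxx : √(n:ℝ) ^ 2 = n := Real.sq_sqrt hn0.le
  have hyy : √(m:ℝ) ^ 2 = m := Real.sq_sqrt hm0.le
  set x := √(n:ℝ) with hxd
  set y := √(m:ℝ) with hyd
  set τ := t / x with hτ
  set s := y / x with hs
  have ht0 : 0 < t := by linarith
  have hτ0 : 0 < τ := by positivity
  have hs0 : 0 < s := by positivity
  have hsτ : s + τ < 1 := by rw [hs, hτ, ← add_div, div_lt_one hx]; exact h
  have hτx : τ * x = t := by rw [hτ]; field_simp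
  have hsx : s * x = y := by rw [hs]; field_simp
  have hE := Real.exp_pos τ
  have hE' := Real.exp_pos (-τ)
  have hEE : Real.exp τ * Real.exp (-τ) = 1 := by rw [← Real.exp_add]; simp
  set k := (n:ℝ) * (1 - Real.exp (-τ)) / 2 with hk
  have hk1 : 1 ≤ k := by have := k_ge n t ht hn; rw [hk]; linarith
  have hmn : (m:ℝ) = n * s ^ 2 := by rw [← hyy, ← hxx, ← hsx]; ring
  have hes : s ≤ Real.exp (-τ) := by have := Real.add_one_le_exp (-τ); linarith
  have hss : s ^ 2 < s := by nlinarith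
  have h2k : ∀ r, (n:ℝ) - r - 2 * k = n * Real.exp (-τ) - r := fun r => by rw [hk]; ring
  have hpos : 0 < (n : ℝ) - (m - 1) - 2 * k := by
    rw [h2k, hmn]; nlinarith
  refine (det_markov n m k _ hk1 (by positivity) hpos).trans ?_
  set q := (y + t) ^ 2 / n + 2 * (y + t) / x with hq
  have hqe : q = (s + τ) ^ 2 + 2 * (s + τ) := by
    rw [hq, ← hxx, ← hsx, ← hτx]; field_simp
  set z := Real.exp τ * s ^ 2 with hz
  have hz1 : z ≤ 1 := by rw [hz]; nlinarith
  have hlog := sum_log2 m hm z (by positivity) hz1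
  have hterm : ∀ i ∈ Finset.range m, ((n : ℝ) - i - 2 * k) ^ (-k) = Real.exp (-k * (Real.log n - τ + Real.log (1 - z * (i / m)))) := by
    intro i hi
    have h1 : (i:ℝ) < m := by exact_mod_cast Finset.mem_range.1 hi
    have h3 : z * (i / m) < 1 := by
      have : (i:ℝ) / m < 1 := by rw [div_lt_one hm0]; exact h1
      have h0 : (0:ℝ) ≤ (i:ℝ) / m := by positivity
      nlinarith
    have h2 : (n : ℝ) - i - 2 * k = n * Real.exp (-τ) * (1 - z * (i / m)) := by
      rw [h2k, hz, hmn]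
      have : (n:ℝ) * Real.exp (-τ) * (1 - Real.exp τ * s ^ 2 * (i / (n * s ^ 2))) = n * Real.exp (-τ) - (Real.exp τ * Real.exp (-τ)) * i := by
        field_simp
      rw [this, hEE]; ring
    have h4 : 0 < 1 - z * (i / m) := by linarith
    rw [h2, Real.rpow_def_of_pos (by positivity), Real.log_mul (by positivity) h4.ne', Real.log_mul hn0.ne' hE'.ne', Real.log_exp]
    congr 1; ring
  rw [Finset.prod_congr rfl hterm, ← Real.exp_sum, ← Finset.mul_sum, Finset.sum_add_distrib, Finset.sum_const, Finset.card_range, nsmul_eq_mul,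
    Real.rpow_def_of_pos (by positivity), Real.log_mul (by positivity) (Real.exp_pos _).ne', Real.log_exp, Real.log_pow, ← Real.exp_add]
  apply Real.exp_le_exp.2
  set Sl := ∑ i ∈ Finset.range m, Real.log (1 - z * (i / m)) with hSl
  have hk0 : 0 < k := by linarith
  have h1 : -k * Sl ≤ k * (z * m) := by have := mul_le_mul_of_nonneg_left hlog hk0.le; linarith
  have hexp : Real.exp τ ≤ 2 * (1 + τ) := by
    have := Real.abs_exp_sub_one_sub_id_le (x := τ) (by rw [abs_of_pos hτ0]; linarith)
    have := (abs_le.1 this).2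
    nlinarith
  have hqq : τ + τ ^ 2 ≤ q - τ - z := by
    rw [hqe, hz]
    have : Real.exp τ * s ^ 2 ≤ 2 * (1 + τ) * s := mul_le_mul hexp hss.le (by positivity) (by positivity)
    nlinarith [sq_nonneg s]
  have hl : τ ^ 2 ≤ (1 - Real.exp (-τ)) * (τ + τ ^ 2) := by
    have := Real.add_one_le_exp τ
    have h2 : Real.exp (-τ) * (1 + τ) ≤ 1 := by nlinarith
    nlinarith
  have h1e : 0 < 1 - Real.exp (-τ) := by
    have : Real.exp (-τ) < 1 := by rw [Real.exp_lt_one_iff]; linarith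
    linarith
  have h5 : t ^ 2 / 2 ≤ k * (τ + τ ^ 2) := by
    rw [hk, ← hτx, mul_pow, hxx]; nlinarith
  have h6 : k * (τ + τ ^ 2) ≤ k * (m * (q - τ - z)) := by
    apply mul_le_mul_of_nonneg_left _ hk0.le
    have : 0 ≤ τ + τ ^ 2 := by positivity
    nlinarith
  have h7 : (↑m * Real.log ↑n + -(↑m * q)) * k + -k * (↑m * (Real.log ↑n - τ) + Sl) = -(k * (m * (q - τ - z))) - k * (z * m) + (-k * Sl) := by ring
  rw [h7]
  linarith

end RG

open MeasureTheory ProbabilityTheory Matrix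
namespace RG

lemma quad_eq {n m : ℕ} (A : Fin n → Fin m → ℝ) (v : Fin m → ℝ) :
    v ⬝ᵥ (((n:ℝ)⁻¹ • ((Matrix.of A)ᵀ * Matrix.of A) - 1).mulVec v) = (n:ℝ)⁻¹ * AN A v ^ 2 - ∑ j, v j ^ 2 := by
  have h1 : AN A v ^ 2 = (Matrix.of A).mulVec v ⬝ᵥ (Matrix.of A).mulVec v := by
    unfold AN
    rw [Real.sq_sqrt (Finset.sum_nonneg fun i _ => sq_nonneg _)]
    simp only [dotProduct, mulVec, Matrix.of_apply]
    refine Finset.sum_congr rfl fun i _ => ?_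
    rw [sq]; simp only [mul_comm]
  rw [h1, sub_mulVec, smul_mulVec, dotProduct_sub, dotProduct_smul, ← mulVec_mulVec, one_mulVec, dotProduct_mulVec, vecMul_transpose, smul_eq_mul]
  congr 1
  simp [dotProduct, sq]

lemma opnorm_of_quad {m : ℕ} (M : Matrix (Fin m) (Fin m) ℝ) (hM : Mᵀ = M) (C : ℝ) 
    (h : ∀ v : Fin m → ℝ, |v ⬝ᵥ M.mulVec v| ≤ C * (v ⬝ᵥ v)) (v : Fin m → ℝ) :
    √(∑ j, (M.mulVec v j) ^ 2) ≤ C * √(∑ j, v j ^ 2) := by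
  have hd : ∀ w : Fin m → ℝ, ∑ j, w j ^ 2 = w ⬝ᵥ w := fun w => by simp [dotProduct, sq]
  rw [hd, hd]
  set w := M.mulVec v with hw
  have ha := Real.sqrt_nonneg (v ⬝ᵥ v)
  have hb := Real.sqrt_nonneg (w ⬝ᵥ w)
  have haa : √(v ⬝ᵥ v) ^ 2 = v ⬝ᵥ v := Real.sq_sqrt (by rw [← hd]; positivity)
  have hbb : √(w ⬝ᵥ w) ^ 2 = w ⬝ᵥ w := Real.sq_sqrt (by rw [← hd]; positivity)
  set a := √(v ⬝ᵥ v)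
  set b := √(w ⬝ᵥ w)
  have hsym : v ⬝ᵥ M.mulVec w = w ⬝ᵥ w := by
    rw [dotProduct_mulVec, ← mulVec_transpose, hM]
  have h1 := (abs_le.1 (h (b • v + a • w))).2
  have h2 := (abs_le.1 (h (b • v - a • w))).1
  have e1 : (b • v + a • w) ⬝ᵥ M.mulVec (b • v + a • w) = b^2 * (v ⬝ᵥ w) + 2 * a * b * (w ⬝ᵥ w) + a^2 * (w ⬝ᵥ M.mulVec w) := by
    simp only [mulVec_add, mulVec_smul, dotProduct_add, add_dotProduct, dotProduct_smul, smul_dotProduct, smul_eq_mul, ← hw, hsym]; ring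
  have e2 : (b • v - a • w) ⬝ᵥ M.mulVec (b • v - a • w) = b^2 * (v ⬝ᵥ w) - 2 * a * b * (w ⬝ᵥ w) + a^2 * (w ⬝ᵥ M.mulVec w) := by
    simp only [mulVec_sub, mulVec_smul, dotProduct_sub, sub_dotProduct, dotProduct_smul, smul_dotProduct, smul_eq_mul, ← hw, hsym]; ring
  have e3 : (b • v + a • w) ⬝ᵥ (b • v + a • w) + (b • v - a • w) ⬝ᵥ (b • v - a • w) = 4 * (a ^ 2 * b ^ 2) := by
    simp only [dotProduct_add, add_dotProduct, dotProduct_sub, sub_dotProduct, dotProduct_smul, smul_dotProduct, smul_eq_mul]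
    rw [← haa, ← hbb]; ring
  rw [e1] at h1
  rw [e2] at h2
  rw [← hbb] at h1 h2
  have h3 : 4 * a * b * b ^ 2 ≤ C * (4 * (a ^ 2 * b ^ 2)) := by rw [← e3]; linarith
  by_cases hb0 : b = 0
  · have h0 := (abs_nonneg _).trans (h v)
    rw [← haa] at h0
    rw [hb0]
    by_cases ha0 : a = 0
    · rw [ha0]; simp
    · have ha1 : 0 < a := lt_of_le_of_ne ha (Ne.symm ha0)
      by_contra hc
      push Not at hc
      nlinarith
  · have hb1 : 0 < b := lt_of_le_of_ne hb (Ne.symm hb0)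
    by_cases ha0 : a = 0
    · have : v = 0 := by
        rw [ha0] at haa
        exact dotProduct_self_eq_zero.1 (by linarith)
      have hw0 : w = 0 := by rw [hw, this, mulVec_zero]
      exfalso; apply hb0
      have : b ^ 2 = 0 := by rw [hbb, hw0]; simp
      exact pow_eq_zero_iff (two_ne_zero) |>.1 this
    · have ha1 : 0 < a := lt_of_le_of_ne ha (Ne.symm ha0)
      have hp : 0 < 4 * a * b ^ 2 := by positivity
      have : (4 * a * b ^ 2) * b ≤ (4 * a * b ^ 2) * (C * a) := by linarith
      exact le_of_mul_le_mul_left this hp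

lemma op_of_sph {n m : ℕ} (A : Fin n → Fin m → ℝ) (hn : 1 ≤ n) (C : ℝ) 
    (h1 : ∀ v : Sph m, AN A v.1 ^ 2 ≤ n * (1 + C)) (h2 : ∀ v : Sph m, n * (1 - C) ≤ AN A v.1 ^ 2) (v : Fin m → ℝ) :
    √(∑ j, ((((n:ℝ)⁻¹ • ((Matrix.of A)ᵀ * Matrix.of A) - 1).mulVec v) j) ^ 2) ≤ C * √(∑ j, v j ^ 2) := by
  have hn0 : (0:ℝ) < n := by positivity
  apply opnorm_of_quad
  · simp [transpose_sub, transpose_smul, transpose_mul]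
  · intro u
    by_cases hu : u = 0
    · simp [hu]
    have hd : ∑ j, u j ^ 2 = u ⬝ᵥ u := by simp [dotProduct, sq]
    have hpos : 0 < u ⬝ᵥ u := lt_of_le_of_ne (by rw [← hd]; positivity) (fun h => hu (dotProduct_self_eq_zero.1 h.symm))
    have hrr : √(u ⬝ᵥ u) ^ 2 = u ⬝ᵥ u := Real.sq_sqrt hpos.le
    have hr : 0 < √(u ⬝ᵥ u) := Real.sqrt_pos.2 hpos
    set r := √(u ⬝ᵥ u)
    have hs : ∑ j, (r⁻¹ • u) j ^ 2 = 1 := by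
      simp only [Pi.smul_apply, smul_eq_mul, mul_pow, ← Finset.mul_sum, hd, ← hrr]
      field_simp
    have hA : AN A (r⁻¹ • u) ^ 2 = (r ^ 2)⁻¹ * AN A u ^ 2 := by
      unfold AN
      rw [Real.sq_sqrt (by positivity : (0:ℝ) ≤ ∑ i, (∑ j, u j * A i j) ^ 2), Real.sq_sqrt (by positivity : (0:ℝ) ≤ ∑ i, (∑ j, (r⁻¹ • u) j * A i j) ^ 2)]
      simp only [Pi.smul_apply, smul_eq_mul, mul_assoc, ← Finset.mul_sum, mul_pow, inv_pow]
    have k1 := h1 ⟨_, hs⟩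
    have k2 := h2 ⟨_, hs⟩
    simp only [hA] at k1 k2
    rw [inv_mul_le_iff₀ (by positivity), hrr] at k1
    rw [le_inv_mul_iff₀ (by positivity), hrr] at k2
    rw [quad_eq, hd, abs_le]
    have k1' : (n:ℝ)⁻¹ * AN A u ^ 2 ≤ (u ⬝ᵥ u) * (1 + C) := by
      rw [inv_mul_le_iff₀ hn0]; linarith
    have k2' : (u ⬝ᵥ u) * (1 - C) ≤ (n:ℝ)⁻¹ * AN A u ^ 2 := by
      rw [le_inv_mul_iff₀ hn0]; linarith
    constructor <;> linarith

lemma norm_tail (n m : ℕ) (hm : 1 ≤ m) (hn : 5 ≤ n) (t : ℝ) (ht : 1.1773 ≤ t) (h : √m + t < √n) :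
    (gaussMatrix n m).real {A | ¬ ∀ v : Fin m → ℝ, √(∑ j, ((((n:ℝ)⁻¹ • ((Matrix.of A)ᵀ * Matrix.of A) - 1).mulVec v) j) ^ 2) ≤ 3 * (√m + t) / √n * √(∑ j, v j ^ 2)} ≤ Real.exp (-t^2/2) := by
  have hP : IsProbabilityMeasure (gaussMatrix n m) := by unfold gaussMatrix; infer_instance
  have hn0 : (0:ℝ) < n := by positivity
  have hx : 0 < √(n:ℝ) := by positivity
  have hy : 1 ≤ √(m:ℝ) := by rw [Real.one_le_sqrt]; exact_mod_cast hm
  have hxx : √(n:ℝ) ^ 2 = n := Real.sq_sqrt hn0.le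
  set x := √(n:ℝ) with hxd
  set y := √(m:ℝ) with hyd
  set s := (y + t) / x with hs
  have hs0 : 0 < s := by positivity
  have hs1 : s < 1 := by rw [hs, div_lt_one hx]; exact h
  have hsx : y + t = s * x := by rw [hs]; field_simp
  have hC : 3 * (y + t) / x = 3 * s := by rw [hs]; ring
  rw [hC]
  have hAN : ∀ (A : Fin n → Fin m → ℝ) v, 0 ≤ AN A v := fun A v => Real.sqrt_nonneg _
  by_cases hs3 : 1 / 3 ≤ s
  · refine le_trans (measureReal_mono ?_) (upper_tail n m (by omega) hm t (by linarith))
    intro A hA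
    simp only [Set.mem_setOf_eq] at hA ⊢
    by_contra hc
    push Not at hc
    apply hA
    apply op_of_sph A (by omega)
    · intro v
      have h1 := hc v
      have h2 : AN A v.1 ≤ x * (1 + s) := by linarith
      have h3 : AN A v.1 ^ 2 ≤ (x * (1 + s)) ^ 2 := pow_le_pow_left₀ (hAN _ _) h2 2
      rw [mul_pow, hxx] at h3
      refine h3.trans (mul_le_mul_of_nonneg_left ?_ hn0.le)
      nlinarith
    · intro v
      have : (n:ℝ) * (1 - 3 * s) ≤ 0 := mul_nonpos_of_nonneg_of_nonpos hn0.le (by linarith)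
      exact this.trans (sq_nonneg _)
  · push Not at hs3
    have hU := upper_tail n m (by omega) hm (1.2 * t + 0.2 * y) (by positivity)
    have h3t : 3 * t ≤ x := by nlinarith
    have hL := lower_tail n m (by omega) hm t (x - 1.5 * (y + t)) (by linarith) (by nlinarith) h3t
    have hsub : {A : Fin n → Fin m → ℝ | ¬ ∀ v : Fin m → ℝ, √(∑ j, ((((n:ℝ)⁻¹ • ((Matrix.of A)ᵀ * Matrix.of A) - 1).mulVec v) j) ^ 2) ≤ 3 * s * √(∑ j, v j ^ 2)} ⊆
       {A | ∃ v : Sph m, x + y + (1.2 * t + 0.2 * y) < AN A v.1} ∪ {A | ∃ v : Sph m, AN A v.1 < x - 1.5 * (y + t)} := by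
      intro A hA
      simp only [Set.mem_setOf_eq, Set.mem_union] at hA ⊢
      by_contra hc
      push Not at hc
      apply hA
      apply op_of_sph A (by omega)
      · intro v
        have h1 := hc.1 v
        have h2 : AN A v.1 ≤ x * (1 + 1.2 * s) := by linarith
        have h3 : AN A v.1 ^ 2 ≤ (x * (1 + 1.2 * s)) ^ 2 := pow_le_pow_left₀ (hAN _ _) h2 2
        rw [mul_pow, hxx] at h3
        refine h3.trans (mul_le_mul_of_nonneg_left ?_ hn0.le)
        nlinarith
      · intro v
        have h1 := hc.2 v
        have h2 : x * (1 - 1.5 * s) ≤ AN A v.1 := by linarith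
        have h3 : (x * (1 - 1.5 * s)) ^ 2 ≤ AN A v.1 ^ 2 := pow_le_pow_left₀ (mul_nonneg hx.le (by linarith)) h2 2
        rw [mul_pow, hxx] at h3
        refine le_trans (mul_le_mul_of_nonneg_left ?_ hn0.le) h3
        nlinarith
    refine (measureReal_mono hsub).trans ((measureReal_union_le _ _).trans ((add_le_add hU hL).trans ?_))
    have ht2 : 1.1773 ^ 2 ≤ t ^ 2 := by gcongr
    have b1 : -(1.2 * t + 0.2 * y) ^ 2 / 2 ≤ -t^2/2 + (-0.6) := by nlinarith
    have b2 : t * (x - 1.5 * (y + t) - x + y) + 3/4 * t ^ 2 ≤ -t^2/2 + (-0.9) := by nlinarith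
    have c1 : Real.exp (-0.6) ≤ 0.555 := by
      rw [Real.exp_neg, inv_le_comm₀ (Real.exp_pos _) (by norm_num)]
      have := Real.sum_le_exp_of_nonneg (x := 0.6) (by norm_num) 5
      norm_num [Finset.sum_range_succ, Nat.factorial] at this ⊢
      linarith
    have c2 : Real.exp (-0.9) ≤ 0.415 := by
      rw [Real.exp_neg, inv_le_comm₀ (Real.exp_pos _) (by norm_num)]
      have := Real.sum_le_exp_of_nonneg (x := 0.9) (by norm_num) 6
      norm_num [Finset.sum_range_succ, Nat.factorial] at this ⊢
      linarith
    have d1 := Real.exp_le_exp.2 b1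
    have d2 := Real.exp_le_exp.2 b2
    rw [Real.exp_add (-t^2/2)] at d1 d2
    have hp := Real.exp_pos (-t^2/2)
    have f1 := mul_le_mul_of_nonneg_left c1 hp.le
    have f2 := mul_le_mul_of_nonneg_left c2 hp.le
    refine (add_le_add d1 d2).trans ?_
    linarith

end RG
theorem random_gram_concentration (n m : ℕ) (t : ℝ) (ht : 0 < t)
    (ht' : t < Real.sqrt n - Real.sqrt m) :
    ENNReal.ofReal (1 - 2 * Real.exp (-t ^ 2 / 2)) ≤
      gaussMatrix n m
        {A | (∀ v : Fin m → ℝ,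
                Real.sqrt (∑ j,
                    ((((n : ℝ)⁻¹ • ((Matrix.of A)ᵀ * Matrix.of A) - 1).mulVec v) j) ^ 2) ≤
                  3 * (Real.sqrt m + t) / Real.sqrt n * Real.sqrt (∑ j, (v j) ^ 2)) ∧
             Real.exp (-((m : ℝ) * ((Real.sqrt m + t) ^ 2 / n +
                 2 * (Real.sqrt m + t) / Real.sqrt n))) ≤
               ((n : ℝ)⁻¹ • ((Matrix.of A)ᵀ * Matrix.of A)).det} := by
  have hP : IsProbabilityMeasure (gaussMatrix n m) := by unfold gaussMatrix; infer_instance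
  by_cases htriv : 1 - 2 * Real.exp (-t ^ 2 / 2) ≤ 0
  · rw [ENNReal.ofReal_of_nonpos htriv]; exact zero_le
  push Not at htriv
  have ht1 : 1.1773 ≤ t := by
    by_contra hc
    push Not at hc
    have h1 : Real.exp (-t^2/2) < Real.exp (- Real.log 2) := by
      rw [Real.exp_neg, Real.exp_log (by norm_num)]; linarith
    have h2 := Real.exp_lt_exp.1 h1
    have h3 := Real.log_two_gt_d9
    nlinarith
  have h : √(m:ℝ) + t < √(n:ℝ) := by linarith
  rcases Nat.eq_zero_or_pos m with rfl | hm
  · have : {A : Fin n → Fin 0 → ℝ | (∀ v : Fin 0 → ℝ, Real.sqrt (∑ j, ((((n : ℝ)⁻¹ • ((Matrix.of A)ᵀ * Matrix.of A) - 1).mulVec v) j) ^ 2) ≤ 3 * (Real.sqrt (0:ℕ) + t) / Real.sqrt n * Real.sqrt (∑ j, (v j) ^ 2)) ∧ Real.exp (-(((0:ℕ) : ℝ) * ((Real.sqrt (0:ℕ) + t) ^ 2 / n + 2 * (Real.sqrt (0:ℕ) + t) / Real.sqrt n))) ≤ ((n : ℝ)⁻¹ • ((Matrix.of A)ᵀ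 * Matrix.of A)).det} = Set.univ := by
      ext A; simp
    rw [this, measure_univ]
    apply ENNReal.ofReal_le_one.2
    have := Real.exp_pos (-t^2/2)
    linarith
  have hy : 1 ≤ √(m:ℝ) := by rw [Real.one_le_sqrt]; exact_mod_cast hm
  have hn : 5 ≤ n := by
    have h1 : 2.1773 < √(n:ℝ) := by linarith
    have h2 : (2.1773:ℝ)^2 < n := by rw [Real.lt_sqrt (by norm_num)] at h1; exact h1
    have : (4:ℝ) < n := by refine lt_trans ?_ h2; norm_num
    exact_mod_cast this
  have hn0 : (0:ℝ) < n := by positivity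
  have hD := RG.det_tail n m hm hn t ht1 h
  have hN := RG.norm_tail n m hm hn t ht1 h
  apply ENNReal.ofReal_le_of_le_toReal
  set G := {A : Fin n → Fin m → ℝ | (∀ v : Fin m → ℝ, Real.sqrt (∑ j, ((((n : ℝ)⁻¹ • ((Matrix.of A)ᵀ * Matrix.of A) - 1).mulVec v) j) ^ 2) ≤ 3 * (Real.sqrt m + t) / Real.sqrt n * Real.sqrt (∑ j, (v j) ^ 2)) ∧ Real.exp (-((m : ℝ) * ((Real.sqrt m + t) ^ 2 / n + 2 * (Real.sqrt m + t) / Real.sqrt n))) ≤ ((n : ℝ)⁻¹ • ((Matrix.of A)ᵀ * Matrix.of A)).det} with hG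
  change _ ≤ (gaussMatrix n m).real G
  set B1 := {A : Fin n → Fin m → ℝ | ((Matrix.of A)ᵀ * Matrix.of A).det < (n:ℝ)^m * Real.exp (-((m:ℝ) * ((√m+t)^2/n + 2*(√m+t)/√n)))} with hB1
  set B2 := {A : Fin n → Fin m → ℝ | ¬ ∀ v : Fin m → ℝ, √(∑ j, ((((n:ℝ)⁻¹ • ((Matrix.of A)ᵀ * Matrix.of A) - 1).mulVec v) j) ^ 2) ≤ 3 * (√m + t) / √n * √(∑ j, v j ^ 2)} with hB2
  have hU : (Set.univ : Set (Fin n → Fin m → ℝ)) ⊆ G ∪ (B1 ∪ B2) := by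
    intro A _
    by_cases h2 : A ∈ B2
    · exact Or.inr (Or.inr h2)
    by_cases h1 : A ∈ B1
    · exact Or.inr (Or.inl h1)
    left
    simp only [hB1, hB2, Set.mem_setOf_eq, not_not, not_lt] at h1 h2
    refine ⟨h2, ?_⟩
    rw [det_smul, Fintype.card_fin, inv_pow, le_inv_mul_iff₀ (by positivity)]
    exact h1
  have h1 := (measureReal_mono (μ := gaussMatrix n m) hU).trans ((measureReal_union_le _ _).trans (add_le_add le_rfl (measureReal_union_le _ _)))
  rw [probReal_univ] at h1
  linarith
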